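/- arXiv:1404.1183 — 4 statements merged into one kernel-verified Lean document; each statement's English description precedes it below -/
import Mathlib

section
/- Let dE be a real finite measure on ℝ such that (1+t²)⁻¹ dE(t) is bounded, let dE be singular with respect to Lebesgue measure, and define S(z) = exp((i/π) ∫_ℝ ((1+tz)/(t-z)) dE(t)) for z in the upper half-plane ℍ. If S admits a meromorphic extension to a neighborhood of every point of ℝ, then dE = 0. -/
open MeasureTheory Complex Real

noncomputable section

open Filter Topology Set

/-- A trapezoid function supported in `Ioo c d`, increasing to its indicator as `n → ∞`. -/
def trapezoid (c d : ℝ) (n : ℕ) (x : ℝ) : ℝ := min 1 (n * max 0 (min (x - c) (d - x)))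

lemma continuous_trapezoid (c d : ℝ) (n : ℕ) : Continuous (trapezoid c d n) := by
  unfold trapezoid; fun_prop

lemma trapezoid_of_notMem {c d x : ℝ} (hx : x ∉ Ioo c d) (n : ℕ) : trapezoid c d n x = 0 := by
  have : min (x - c) (d - x) ≤ 0 := by
    by_contra! h
    rw [lt_min_iff] at h
    exact hx ⟨by linarith [h.1], by linarith [h.2]⟩
  simp [trapezoid, max_eq_left this]

lemma trapezoid_nonneg (c d : ℝ) (n : ℕ) (x : ℝ) : 0 ≤ trapezoid c d n x :=
  le_min zero_le_one (by positivity)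

lemma norm_trapezoid_le (c d : ℝ) (n : ℕ) (x : ℝ) : ‖trapezoid c d n x‖ ≤ 1 := by
  rw [Real.norm_of_nonneg (trapezoid_nonneg c d n x)]
  exact min_le_left _ _

lemma tendsto_trapezoid (c d x : ℝ) :
    Tendsto (fun n ↦ trapezoid c d n x) atTop (𝓝 ((Ioo c d).indicator 1 x)) := by
  by_cases hx : x ∈ Ioo c d
  · rw [indicator_of_mem hx]
    have hpos : 0 < max 0 (min (x - c) (d - x)) :=
      lt_max_of_lt_right (lt_min (by linarith [hx.1]) (by linarith [hx.2]))
    have h1 : Tendsto (fun n : ℕ ↦ (n : ℝ) * max 0 (min (x - c) (d - x))) atTop atTop :=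
      tendsto_natCast_atTop_atTop.atTop_mul_const hpos
    refine tendsto_const_nhds.congr' ?_
    filter_upwards [h1.eventually_ge_atTop 1] with n hn
    simp [trapezoid, min_eq_left hn]
  · rw [indicator_of_notMem hx]
    simp [trapezoid_of_notMem hx]

lemma tendsto_integral_trapezoid (μ : Measure ℝ) {c d : ℝ} {k : ℝ → ℝ} (hk : Integrable k μ) :
    Tendsto (fun n ↦ ∫ x, trapezoid c d n x * k x ∂μ) atTop (𝓝 (∫ x in Ioo c d, k x ∂μ)) := by
  rw [← integral_indicator measurableSet_Ioo]
  refine tendsto_integral_of_dominated_convergence (fun x ↦ ‖k x‖) (fun n ↦ ?_) hk.norm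
    (fun n ↦ ?_) ?_
  · exact (continuous_trapezoid c d n).aestronglyMeasurable.mul hk.aestronglyMeasurable
  · refine ae_of_all _ fun x ↦ ?_
    rw [norm_mul]
    exact mul_le_of_le_one_left (norm_nonneg _) (norm_trapezoid_le c d n x)
  · refine ae_of_all _ fun x ↦ ?_
    have := (tendsto_trapezoid c d x).mul_const (k x)
    convert this using 2
    by_cases hx : x ∈ Ioo c d <;> simp [hx]

lemma MeasureTheory.Integrable.inv_one_add_sq_mul {μ : Measure ℝ} {h : ℝ → ℝ}
    (hh : Integrable h μ) : Integrable (fun x ↦ (1 + x ^ 2)⁻¹ * h x) μ := by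
  refine hh.bdd_mul (c := 1) ?_ (ae_of_all _ fun x ↦ ?_)
  · exact (Continuous.inv₀ (by fun_prop) fun x ↦ by positivity).aestronglyMeasurable
  · rw [Real.norm_of_nonneg (by positivity)]
    exact inv_le_one_of_one_le₀ (by nlinarith [sq_nonneg x])

lemma measureReal_Ioo_sub_eq_setIntegral (μ ν : Measure ℝ) [IsFiniteMeasure μ] [IsFiniteMeasure ν]
    {a b : ℝ} {h : ℝ → ℝ} (hh : IntegrableOn h (Ioo a b))
    (H : ∀ φ : ℝ → ℝ, Continuous φ → (∀ x ∉ Ioo a b, φ x = 0) →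
      ∫ x, φ x * (1 + x ^ 2) ∂μ - ∫ x, φ x * (1 + x ^ 2) ∂ν = ∫ x in Ioo a b, φ x * h x)
    {c d : ℝ} (hcd : Ioo c d ⊆ Ioo a b) :
    μ.real (Ioo c d) - ν.real (Ioo c d) = ∫ x in Ioo c d, (1 + x ^ 2)⁻¹ * h x := by
  have hk : IntegrableOn (fun x ↦ (1 + x ^ 2)⁻¹ * h x) (Ioo a b) :=
    Integrable.inv_one_add_sq_mul hh
  have h1 := tendsto_integral_trapezoid μ (c := c) (d := d) (integrable_const (1 : ℝ))
  have h2 := tendsto_integral_trapezoid ν (c := c) (d := d) (integrable_const (1 : ℝ))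
  have h3 := tendsto_integral_trapezoid _ (c := c) (d := d) hk
  rw [Measure.restrict_restrict measurableSet_Ioo, inter_eq_left.2 hcd] at h3
  have h4 := h1.sub h2
  simp only [setIntegral_const, smul_eq_mul, mul_one] at h4
  refine tendsto_nhds_unique (h4.congr fun n ↦ ?_) h3
  have := H (fun x ↦ trapezoid c d n x * (1 + x ^ 2)⁻¹)
    ((continuous_trapezoid c d n).mul (Continuous.inv₀ (by fun_prop) fun x ↦ by positivity))
    (fun x hx ↦ by rw [trapezoid_of_notMem fun h ↦ hx (hcd h), zero_mul])
  have e (x : ℝ) : trapezoid c d n x * (1 + x ^ 2)⁻¹ * (1 + x ^ 2) = trapezoid c d n x := by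
    have : 1 + x ^ 2 ≠ 0 := by positivity
    field_simp
  simp only [e] at this
  simp only [this, mul_assoc]

lemma restrict_Ioo_eq_of_forall_integral (μ ν : Measure ℝ) [IsFiniteMeasure μ] [IsFiniteMeasure ν]
    (hμs : μ ⟂ₘ (volume : Measure ℝ)) (hνs : ν ⟂ₘ (volume : Measure ℝ))
    {a b : ℝ} {h : ℝ → ℝ} (hh : IntegrableOn h (Ioo a b))
    (H : ∀ φ : ℝ → ℝ, Continuous φ → (∀ x ∉ Ioo a b, φ x = 0) →
      ∫ x, φ x * (1 + x ^ 2) ∂μ - ∫ x, φ x * (1 + x ^ 2) ∂ν = ∫ x in Ioo a b, φ x * h x) :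
    μ.restrict (Ioo a b) = ν.restrict (Ioo a b) := by
  set B := Ioo a b
  wlog hm : Measurable h generalizing h
  · have hae := hh.aestronglyMeasurable.aemeasurable.ae_eq_mk
    refine this (h := hh.aestronglyMeasurable.aemeasurable.mk h) (hh.congr hae)
      (fun φ hφ h0 ↦ ?_) hh.aestronglyMeasurable.aemeasurable.measurable_mk
    rw [H φ hφ h0]
    refine integral_congr_ae ?_
    filter_upwards [hae] with x hx
    rw [hx]
  set k : ℝ → ℝ := fun x ↦ (1 + x ^ 2)⁻¹ * h x
  have hkm : Measurable k := by fun_prop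
  have hk : IntegrableOn k B :=
    Integrable.inv_one_add_sq_mul hh
  set V := volume.restrict B
  have key : μ.restrict B + V.withDensity (fun x ↦ ENNReal.ofReal (-k x)) =
      ν.restrict B + V.withDensity (fun x ↦ ENNReal.ofReal (k x)) := by
    have f1 : IsFiniteMeasure (V.withDensity (fun x ↦ ENNReal.ofReal (k x))) :=
      isFiniteMeasure_withDensity_ofReal hk.2
    have f2 : IsFiniteMeasure (V.withDensity (fun x ↦ ENNReal.ofReal (-k x))) :=
      isFiniteMeasure_withDensity_ofReal hk.neg.2
    refine Real.measure_ext_Ioo_rat fun c d ↦ ?_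
    have hI : Ioo (c : ℝ) d ∩ B = Ioo (max (c : ℝ) a) (min (d : ℝ) b) := Ioo_inter_Ioo
    have h1 := measureReal_Ioo_sub_eq_setIntegral μ ν hh H (hI ▸ inter_subset_right)
    rw [← hI] at h1
    rw [integral_eq_lintegral_pos_part_sub_lintegral_neg_part
      (hk.mono_set inter_subset_right)] at h1
    have h2 := (measure_lt_top (V.withDensity (fun x ↦ ENNReal.ofReal (k x))) (Ioo (c:ℝ) d)).ne
    have h3 := (measure_lt_top (V.withDensity (fun x ↦ ENNReal.ofReal (-k x))) (Ioo (c:ℝ) d)).ne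
    rw [withDensity_apply _ measurableSet_Ioo, Measure.restrict_restrict measurableSet_Ioo]
      at h2 h3
    simp only [Measure.add_apply, withDensity_apply _ (measurableSet_Ioo (a := (c:ℝ)) (b := d)),
      Measure.restrict_apply (measurableSet_Ioo (a := (c:ℝ)) (b := d)), V,
      Measure.restrict_restrict (measurableSet_Ioo (a := (c:ℝ)) (b := d))]
    rw [← ENNReal.toReal_eq_toReal_iff' (ENNReal.add_ne_top.2 ⟨measure_ne_top _ _, h3⟩)
      (ENNReal.add_ne_top.2 ⟨measure_ne_top _ _, h2⟩),
      ENNReal.toReal_add (measure_ne_top _ _) h3, ENNReal.toReal_add (measure_ne_top _ _) h2]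
    simp only [Measure.real] at h1
    linarith
  have s1 : μ.restrict B ⟂ₘ V := (hμs.restrict B).mono_ac .rfl Measure.absolutelyContinuous_restrict
  have s2 : ν.restrict B ⟂ₘ V := (hνs.restrict B).mono_ac .rfl Measure.absolutelyContinuous_restrict
  rw [Measure.eq_singularPart (f := fun x ↦ ENNReal.ofReal (-k x)) hkm.neg.ennreal_ofReal s1 rfl, key,
    ← Measure.eq_singularPart hkm.ennreal_ofReal s2 rfl]

/-- The Poisson kernel of the upper half-plane, weighted by `1 + t ^ 2`. -/
def weightedPoisson (y x t : ℝ) : ℝ := (1 + t ^ 2) * (y / ((t - x) ^ 2 + y ^ 2))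

lemma weightedPoisson_nonneg {y : ℝ} (hy : 0 < y) (x t : ℝ) : 0 ≤ weightedPoisson y x t := by
  unfold weightedPoisson; positivity

lemma weightedPoisson_le {y : ℝ} (hy : 0 < y) (x t : ℝ) :
    weightedPoisson y x t ≤ (1 + 2 * x ^ 2) / y + 2 * y := by
  unfold weightedPoisson
  rw [← mul_div_assoc, div_add' _ _ _ hy.ne', div_le_div_iff₀ (by positivity) hy]
  nlinarith [sq_nonneg (t - x), sq_nonneg (t - 2 * x), sq_nonneg y, sq_nonneg (x * (t - x)),
    sq_nonneg ((t - x) * y), sq_nonneg (y * (t - 2 * x)), sq_nonneg (y^2)]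

lemma integrable_mul_weightedPoisson (μ : Measure ℝ) [IsFiniteMeasure μ] {φ : ℝ → ℝ}
    (hφ : Continuous φ) (hs : HasCompactSupport φ) {y : ℝ} (hy : 0 < y) :
    Integrable (Function.uncurry fun x t ↦ φ x * weightedPoisson y x t) (volume.prod μ) := by
  have hb : Integrable (fun x ↦ |φ x| * ((1 + 2 * x ^ 2) / y + 2 * y)) :=
    Continuous.integrable_of_hasCompactSupport (by fun_prop)
      ((hs.comp_left (g := fun r : ℝ ↦ |r|) abs_zero).mul_right)
  refine (hb.comp_fst μ).mono' ?_ (ae_of_all _ fun p ↦ ?_)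
  · refine Continuous.aestronglyMeasurable ?_
    unfold weightedPoisson Function.uncurry
    refine (hφ.comp continuous_fst).mul (Continuous.mul (by fun_prop)
      (continuous_const.div (by fun_prop) fun p ↦ by positivity))
  · simp only [Function.uncurry, norm_mul, Real.norm_eq_abs]
    rw [abs_of_nonneg (weightedPoisson_nonneg hy _ _)]
    exact mul_le_mul_of_nonneg_left (weightedPoisson_le hy _ _) (abs_nonneg _)

lemma integral_mul_weightedPoisson (φ : ℝ → ℝ) {y : ℝ} (hy : 0 < y) (t : ℝ) :
    ∫ x, φ x * weightedPoisson y x t =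
      ∫ s, φ (t + y * s) * ((1 + t ^ 2) * (1 + s ^ 2)⁻¹) := by
  have h1 := integral_add_left_eq_self (μ := (volume : Measure ℝ))
    (fun x ↦ φ x * weightedPoisson y x t) t
  have h2 := Measure.integral_comp_mul_left (fun u ↦ φ (t + u) * weightedPoisson y (t + u) t) y
  rw [h1, abs_of_pos (inv_pos.2 hy), smul_eq_mul, inv_mul_eq_div, eq_div_iff hy.ne',
    ← integral_mul_const] at h2
  rw [← h2]
  congr with s
  have : 1 + s ^ 2 ≠ 0 := by positivity
  have : (t - (t + y * s)) ^ 2 + y ^ 2 = y ^ 2 * (1 + s ^ 2) := by ring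
  rw [weightedPoisson, this]
  field_simp

lemma norm_integral_mul_weightedPoisson_le {φ : ℝ → ℝ} (hφ : Continuous φ)
    (hs : HasCompactSupport φ) {M : ℝ} (hM : ∀ x, |φ x| * (1 + 2 * x ^ 2) ≤ M)
    {y : ℝ} (hy : 0 < y) (t : ℝ) :
    ‖∫ x, φ x * weightedPoisson y x t‖ ≤ M * π + 2 * y * ∫ x, |φ x| := by
  have hi : Integrable (fun x ↦ |φ x|) := (hφ.integrable_of_hasCompactSupport hs).norm
  have e : ∫ s, 2 * y ^ 2 * |φ (t + y * s)| = 2 * y * ∫ x, |φ x| := by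
    have h1 := integral_add_left_eq_self (μ := (volume : Measure ℝ)) (fun x ↦ |φ x|) t
    have h2 := Measure.integral_comp_mul_left (fun u ↦ |φ (t + u)|) y
    rw [integral_const_mul, h2, h1, abs_of_pos (inv_pos.2 hy), smul_eq_mul]
    field_simp
  have hi2 : Integrable (fun s ↦ 2 * y ^ 2 * |φ (t + y * s)|) :=
    ((hi.comp_add_left t).comp_mul_left' hy.ne').const_mul _
  have hi3 := integrable_inv_one_add_sq.const_mul M
  rw [integral_mul_weightedPoisson φ hy, ← e, ← integral_univ_inv_one_add_sq,
    ← integral_const_mul, ← integral_add hi3 hi2]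
  refine norm_integral_le_of_norm_le (hi3.add hi2) (ae_of_all _ fun s ↦ ?_)
  rw [norm_mul, Real.norm_eq_abs, Real.norm_of_nonneg (by positivity)]
  have h1 : 1 + t ^ 2 ≤ (1 + 2 * (t + y * s) ^ 2) + 2 * y ^ 2 * (1 + s ^ 2) := by
    nlinarith [sq_nonneg (t + 2 * (y * s)), sq_nonneg y]
  calc |φ (t + y * s)| * ((1 + t ^ 2) * (1 + s ^ 2)⁻¹)
      ≤ |φ (t + y * s)| * (((1 + 2 * (t + y * s) ^ 2) + 2 * y ^ 2 * (1 + s ^ 2)) *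
        (1 + s ^ 2)⁻¹) := by gcongr
    _ = |φ (t + y * s)| * (1 + 2 * (t + y * s) ^ 2) * (1 + s ^ 2)⁻¹ +
        2 * y ^ 2 * |φ (t + y * s)| := by
      have : 1 + s ^ 2 ≠ 0 := by positivity
      field_simp
    _ ≤ _ := by gcongr; exact hM _

lemma tendsto_integral_mul_weightedPoisson {φ : ℝ → ℝ} (hφ : Continuous φ)
    (hs : HasCompactSupport φ) (t : ℝ) :
    Tendsto (fun y ↦ ∫ x, φ x * weightedPoisson y x t) (𝓝[>] 0)
      (𝓝 (π * (φ t * (1 + t ^ 2)))) := by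
  obtain ⟨C, hC⟩ := hs.exists_bound_of_continuous hφ
  have e : π * (φ t * (1 + t ^ 2)) = ∫ s : ℝ, φ t * ((1 + t ^ 2) * (1 + s ^ 2)⁻¹) := by
    rw [integral_const_mul, integral_const_mul, integral_univ_inv_one_add_sq]; ring
  rw [e]
  have : Tendsto (fun y ↦ ∫ s, φ (t + y * s) * ((1 + t ^ 2) * (1 + s ^ 2)⁻¹)) (𝓝[>] 0)
      (𝓝 (∫ s : ℝ, φ t * ((1 + t ^ 2) * (1 + s ^ 2)⁻¹))) := by
    refine tendsto_integral_filter_of_dominated_convergence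
      (fun s ↦ C * ((1 + t ^ 2) * (1 + s ^ 2)⁻¹)) (Eventually.of_forall fun y ↦ ?_)
      (Eventually.of_forall fun y ↦ ae_of_all _ fun s ↦ ?_)
      ((integrable_inv_one_add_sq.const_mul _).const_mul _) (ae_of_all _ fun s ↦ ?_)
    · refine Continuous.aestronglyMeasurable (Continuous.mul (by fun_prop)
        (continuous_const.mul (Continuous.inv₀ (by fun_prop) fun x ↦ by positivity)))
    · rw [norm_mul, Real.norm_of_nonneg (r := (1 + t ^ 2) * _) (by positivity)]
      gcongr
      exact hC _
    · refine Tendsto.mul_const _ ?_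
      have : Continuous fun y ↦ φ (t + y * s) := by fun_prop
      simpa using (this.tendsto 0).mono_left nhdsWithin_le_nhds
  refine this.congr' ?_
  filter_upwards [self_mem_nhdsWithin] with y hy
  rw [integral_mul_weightedPoisson φ hy]

lemma tendsto_integral_integral_weightedPoisson (μ : Measure ℝ) [IsFiniteMeasure μ] {φ : ℝ → ℝ}
    (hφ : Continuous φ) (hs : HasCompactSupport φ) :
    Tendsto (fun y ↦ ∫ x, φ x * ∫ t, weightedPoisson y x t ∂μ) (𝓝[>] 0)
      (𝓝 (π * ∫ t, φ t * (1 + t ^ 2) ∂μ)) := by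
  obtain ⟨M, hM⟩ := (hs.mul_right (f' := fun x : ℝ ↦ 1 + 2 * x ^ 2)).exists_bound_of_continuous
    (by fun_prop)
  replace hM (x : ℝ) : |φ x| * (1 + 2 * x ^ 2) ≤ M := by
    have := hM x
    simp only [Pi.mul_apply, norm_mul, Real.norm_eq_abs] at this
    rwa [abs_of_nonneg (a := 1 + 2 * x ^ 2) (by positivity)] at this
  rw [← integral_const_mul]
  have : Tendsto (fun y ↦ ∫ t, (∫ x, φ x * weightedPoisson y x t) ∂μ) (𝓝[>] 0)
      (𝓝 (∫ t, π * (φ t * (1 + t ^ 2)) ∂μ)) := by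
    refine tendsto_integral_filter_of_dominated_convergence
      (fun _ ↦ M * π + 2 * ∫ x, |φ x|) ?_ ?_ (integrable_const _)
      (ae_of_all _ fun t ↦ tendsto_integral_mul_weightedPoisson hφ hs t)
    · filter_upwards [self_mem_nhdsWithin] with y hy
      exact (integrable_mul_weightedPoisson μ hφ hs hy).integral_prod_right.aestronglyMeasurable
    · filter_upwards [Ioo_mem_nhdsGT (zero_lt_one (α := ℝ))] with y hy
      refine ae_of_all _ fun t ↦ (norm_integral_mul_weightedPoisson_le hφ hs hM hy.1 t).trans ?_
      have : 0 ≤ ∫ x, |φ x| := integral_nonneg fun x ↦ abs_nonneg _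
      nlinarith [hy.2]
  refine this.congr' ?_
  filter_upwards [self_mem_nhdsWithin] with y hy
  rw [← integral_integral_swap (integrable_mul_weightedPoisson μ hφ hs hy)]
  simp only [integral_const_mul]

lemma im_kernel (z : ℂ) (t : ℝ) :
    ((1 + (t : ℂ) * z) / ((t : ℂ) - z)).im = weightedPoisson z.im z.re t := by
  have : Complex.normSq ((t : ℂ) - z) = (t - z.re) ^ 2 + z.im ^ 2 := by
    simp [Complex.normSq_apply]; ring
  rw [Complex.div_im, this, weightedPoisson, ← sub_div, ← mul_div_assoc]
  simp only [Complex.add_im, Complex.one_im, Complex.mul_im, Complex.ofReal_re, Complex.ofReal_im,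
    Complex.sub_re, Complex.sub_im, Complex.add_re, Complex.one_re, Complex.mul_re]
  ring

lemma integrable_kernel (μ : Measure ℝ) [IsFiniteMeasure μ] {z : ℂ} (hz : 0 < z.im) :
    Integrable (fun t : ℝ ↦ (1 + (t : ℂ) * z) / ((t : ℂ) - z)) μ := by
  have him (t : ℝ) : z.im ≤ ‖(t : ℂ) - z‖ := by
    have := Complex.abs_im_le_norm ((t : ℂ) - z)
    simp only [Complex.sub_im, Complex.ofReal_im, zero_sub, abs_neg] at this
    exact (le_abs_self _).trans this
  have hne (t : ℝ) : (t : ℂ) - z ≠ 0 := norm_pos_iff.1 (hz.trans_le (him t))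
  refine Integrable.of_bound (C := ‖1 + z ^ 2‖ / z.im + ‖z‖) ?_ (ae_of_all _ fun t ↦ ?_)
  · exact (Continuous.div (by fun_prop) (by fun_prop) hne).aestronglyMeasurable
  · have : (1 + (t : ℂ) * z) / ((t : ℂ) - z) = (1 + z ^ 2) / ((t : ℂ) - z) + z := by
      have := hne t
      field_simp
      ring
    rw [this]
    refine (norm_add_le _ _).trans ?_
    rw [norm_div]
    gcongr
    exact him t

lemma im_integral_kernel (μ : Measure ℝ) [IsFiniteMeasure μ] {z : ℂ} (hz : 0 < z.im) :
    (∫ t : ℝ, (1 + (t : ℂ) * z) / ((t : ℂ) - z) ∂μ).im =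
      ∫ t, weightedPoisson z.im z.re t ∂μ := by
  simp only [← im_kernel]
  exact (integral_im (integrable_kernel μ hz)).symm

lemma log_norm_exp_kernel (μ ν : Measure ℝ) [IsFiniteMeasure μ] [IsFiniteMeasure ν] {z : ℂ}
    (hz : 0 < z.im) :
    Real.log ‖Complex.exp ((Complex.I / (π : ℂ)) *
        ((∫ t : ℝ, (1 + (t : ℂ) * z) / ((t : ℂ) - z) ∂μ) -
         (∫ t : ℝ, (1 + (t : ℂ) * z) / ((t : ℂ) - z) ∂ν)))‖ =
      -π⁻¹ * (∫ t, weightedPoisson z.im z.re t ∂μ - ∫ t, weightedPoisson z.im z.re t ∂ν) := by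
  rw [Complex.norm_exp, Real.log_exp, ← im_integral_kernel μ hz, ← im_integral_kernel ν hz,
    ← Complex.sub_im]
  rw [div_eq_mul_inv, mul_assoc, ← Complex.ofReal_inv, Complex.I_mul_re, Complex.im_ofReal_mul]
  ring

/-- Near a point where it does not vanish identically, a meromorphic function has
`log ‖f z‖ = n * log ‖z - x₀‖ + log ‖g z‖` with `g` continuous and `log ‖g‖` bounded. -/
lemma MeromorphicAt.exists_log_norm_eq {f : ℂ → ℂ} {x₀ : ℂ} (hf : MeromorphicAt f x₀)
    (h0 : ∃ᶠ z in 𝓝[≠] x₀, f z ≠ 0) :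
    ∃ (n : ℤ) (g : ℂ → ℂ) (C : ℝ), ∀ᶠ z in 𝓝 x₀,
      ContinuousAt (fun w ↦ Real.log ‖g w‖) z ∧ |Real.log ‖g z‖| ≤ C ∧
      (z ≠ x₀ → Real.log ‖f z‖ = n * Real.log ‖z - x₀‖ + Real.log ‖g z‖) := by
  have htop : meromorphicOrderAt f x₀ ≠ ⊤ := by
    rw [Ne, meromorphicOrderAt_eq_top_iff]
    exact fun h ↦ h0 (h.mono fun z hz ↦ not_not.2 hz)
  obtain ⟨n, hn⟩ := WithTop.ne_top_iff_exists.1 htop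
  obtain ⟨g, hg, hg0, hfg⟩ := (meromorphicOrderAt_eq_int_iff hf).1 hn.symm
  have hc : ContinuousAt (fun w ↦ |Real.log ‖g w‖|) x₀ :=
    (hg.continuousAt.norm.log (norm_ne_zero_iff.2 hg0)).abs
  refine ⟨n, g, |Real.log ‖g x₀‖| + 1, ?_⟩
  filter_upwards [hg.eventually_analyticAt, hg.continuousAt.eventually_ne hg0,
    hc.eventually_le_const (lt_add_one _), eventually_nhdsWithin_iff.1 hfg] with z h1 h2 h3 h4
  refine ⟨h1.continuousAt.norm.log (norm_ne_zero_iff.2 h2), h3, fun hz ↦ ?_⟩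
  rw [h4 hz, norm_smul, norm_zpow, Real.log_mul (zpow_ne_zero _ (norm_ne_zero_iff.2
    (sub_ne_zero.2 hz))) (norm_ne_zero_iff.2 h2), Real.log_zpow]

lemma integrableOn_log_abs_sub (x₀ a b : ℝ) :
    IntegrableOn (fun x ↦ Real.log |x - x₀|) (Ioo a b) := by
  have h : IntervalIntegrable Real.log volume (a - x₀) (b - x₀) :=
    intervalIntegral.intervalIntegrable_log'
  have h2 := h.comp_sub_right x₀
  simp only [sub_add_cancel] at h2
  rcases le_or_gt a b with hab | hab
  · simp only [Real.log_abs]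
    exact ((intervalIntegrable_iff_integrableOn_Ioo_of_le hab).1 h2)
  · simp [Ioo_eq_empty_of_le hab.le]

lemma tendsto_integral_mul_log_norm {F : ℂ → ℝ} {G : ℂ → ℝ} {x₀ r C : ℝ} {n : ℤ} (hr1 : r ≤ 1 / 2)
    (hr : 0 < r)
    (hG : ∀ z ∈ Metric.ball (x₀ : ℂ) (2 * r), ContinuousAt G z ∧ |G z| ≤ C ∧
      (0 < z.im → F z = n * Real.log ‖z - x₀‖ + G z))
    {φ : ℝ → ℝ} (hφ : Continuous φ) (h0 : ∀ x ∉ Ioo (x₀ - r) (x₀ + r), φ x = 0)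
    (hF : ∀ y : ℝ, 0 < y → Integrable fun x : ℝ ↦ φ x * F (x + y * Complex.I)) :
    Tendsto (fun y : ℝ ↦ ∫ x : ℝ, φ x * F (x + y * Complex.I)) (𝓝[>] 0)
      (𝓝 (∫ x in Ioo (x₀ - r) (x₀ + r), φ x * (n * Real.log |x - x₀| + G x))) := by
  obtain ⟨D, hD⟩ := (HasCompactSupport.intro (isCompact_Icc (a := x₀ - r) (b := x₀ + r))
    fun x hx ↦ h0 x fun h ↦ hx (Ioo_subset_Icc_self h)).exists_bound_of_continuous hφ
  have hball {x y : ℝ} (hx : x ∈ Ioo (x₀ - r) (x₀ + r)) (hy : |y| < r) :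
      (x + y * Complex.I : ℂ) ∈ Metric.ball (x₀ : ℂ) (2 * r) := by
    have hx' : |x - x₀| < r := abs_lt.2 ⟨by linarith [hx.1], by linarith [hx.2]⟩
    rw [Metric.mem_ball, dist_eq_norm]
    calc ‖(x + y * Complex.I : ℂ) - x₀‖ = ‖((x - x₀ : ℝ) : ℂ) + y * Complex.I‖ := by
          push_cast; ring_nf
      _ ≤ |x - x₀| + |y| := by
          refine (norm_add_le _ _).trans_eq ?_
          rw [norm_mul, Complex.norm_I, mul_one, Complex.norm_real, Complex.norm_real,
            Real.norm_eq_abs, Real.norm_eq_abs]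
      _ < 2 * r := by linarith
  have hlog := integrableOn_log_abs_sub x₀ (x₀ - r) (x₀ + r)
  have : Tendsto (fun y : ℝ ↦ ∫ x in Ioo (x₀ - r) (x₀ + r), φ x * F (x + y * Complex.I)) (𝓝[>] 0)
      (𝓝 (∫ x in Ioo (x₀ - r) (x₀ + r), φ x * (n * Real.log |x - x₀| + G x))) := by
    refine tendsto_integral_filter_of_dominated_convergence
      (fun x ↦ D * (|(n : ℝ)| * |Real.log (|x - x₀|)| + C)) ?_ ?_
      (((hlog.abs.const_mul _).add (integrable_const _)).const_mul _) ?_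
    · filter_upwards [self_mem_nhdsWithin] with y hy
      exact (hF y hy).aestronglyMeasurable.restrict
    · filter_upwards [Ioo_mem_nhdsGT hr] with y hy
      have hne : ∀ᵐ x ∂(volume.restrict (Ioo (x₀ - r) (x₀ + r))), x ≠ x₀ :=
        ae_restrict_of_ae (Measure.ae_ne volume x₀)
      filter_upwards [ae_restrict_mem measurableSet_Ioo, hne] with x hx hxne
      obtain ⟨-, h2, h3⟩ := hG _ (hball hx ((abs_of_pos hy.1).trans_lt hy.2))
      rw [norm_mul, h3 (by simpa using hy.1), Real.norm_eq_abs (n * _ + _)]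
      have hle : |x - x₀| ≤ ‖(x + y * Complex.I : ℂ) - x₀‖ := by
        simpa using Complex.abs_re_le_norm ((x + y * Complex.I : ℂ) - x₀)
      have hle1 : ‖(x + y * Complex.I : ℂ) - x₀‖ ≤ 1 := by
        have := hball hx ((abs_of_pos hy.1).trans_lt hy.2)
        rw [Metric.mem_ball, dist_eq_norm] at this
        linarith
      have hpos : 0 < |x - x₀| := abs_pos.2 (sub_ne_zero.2 hxne)
      have hlogle : |Real.log ‖(x + y * Complex.I : ℂ) - x₀‖| ≤ |Real.log (|x - x₀|)| := by
        rw [abs_of_nonpos (Real.log_nonpos (norm_nonneg _) hle1),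
          abs_of_nonpos (Real.log_nonpos hpos.le (hle.trans hle1))]
        exact neg_le_neg (Real.log_le_log hpos hle)
      have hD0 : 0 ≤ D := (norm_nonneg _).trans (hD x)
      gcongr
      · exact hD x
      · refine (abs_add_le _ _).trans ?_
        rw [abs_mul]
        gcongr
    · have hne : ∀ᵐ x ∂(volume.restrict (Ioo (x₀ - r) (x₀ + r))), x ≠ x₀ :=
        ae_restrict_of_ae (Measure.ae_ne volume x₀)
      filter_upwards [ae_restrict_mem measurableSet_Ioo, hne] with x hx hxne
      have hx0 : (x : ℂ) ∈ Metric.ball (x₀ : ℂ) (2 * r) := by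
        simpa using hball (y := 0) hx (by simpa using hr)
      have hc : Tendsto (fun y : ℝ ↦ (x + y * Complex.I : ℂ)) (𝓝[>] 0) (𝓝 x) := by
        have : Continuous fun y : ℝ ↦ (x + y * Complex.I : ℂ) := by fun_prop
        simpa using (this.tendsto 0).mono_left nhdsWithin_le_nhds
      have hG1 := (hG _ hx0).1.tendsto.comp hc
      have hn : ‖(x : ℂ) - x₀‖ = |x - x₀| := by
        rw [← Complex.ofReal_sub, Complex.norm_real, Real.norm_eq_abs]
      have hl := ((hc.sub_const (x₀ : ℂ)).norm.log
        (by rw [hn]; exact abs_ne_zero.2 (sub_ne_zero.2 hxne))).const_mul (n : ℝ)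
      rw [hn] at hl
      refine ((hl.add hG1).const_mul (φ x)).congr' ?_
      filter_upwards [Ioo_mem_nhdsGT hr] with y hy
      obtain ⟨-, -, h3⟩ := hG _ (hball hx ((abs_of_pos hy.1).trans_lt hy.2))
      rw [h3 (by simpa using hy.1)]
      rfl
  refine this.congr fun y ↦ setIntegral_eq_integral_of_forall_compl_eq_zero fun x hx ↦ ?_
  rw [h0 x hx, zero_mul]

/-- If `exp ((i/π) ∫ (1+tz)/(t-z) d(μ-ν))` extends meromorphically to `x₀`, then `μ` and `ν` agree
near `x₀`. -/
lemma exists_restrict_Ioo_eq (μ ν : Measure ℝ) [IsFiniteMeasure μ] [IsFiniteMeasure ν]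
    (hμs : μ ⟂ₘ (volume : Measure ℝ)) (hνs : ν ⟂ₘ (volume : Measure ℝ)) {S S' : ℂ → ℂ}
    (hS : ∀ z : ℂ, 0 < z.im → S z =
      Complex.exp ((Complex.I / (π : ℂ)) *
        ((∫ t : ℝ, (1 + (t : ℂ) * z) / ((t : ℂ) - z) ∂μ) -
         (∫ t : ℝ, (1 + (t : ℂ) * z) / ((t : ℂ) - z) ∂ν))))
    {x₀ : ℝ} (hS' : MeromorphicAt S' x₀) (hSS' : ∀ᶠ z in 𝓝 (x₀ : ℂ), 0 < z.im → S' z = S z) :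
    ∃ r > 0, μ.restrict (Ioo (x₀ - r) (x₀ + r)) = ν.restrict (Ioo (x₀ - r) (x₀ + r)) := by
  have hfreq : ∃ᶠ z in 𝓝[≠] (x₀ : ℂ), S' z ≠ 0 := by
    have hc : Tendsto (fun y : ℝ ↦ (x₀ + y * Complex.I : ℂ)) (𝓝[>] 0) (𝓝[≠] (x₀ : ℂ)) := by
      refine tendsto_nhdsWithin_iff.2 ⟨?_, ?_⟩
      · have : Continuous fun y : ℝ ↦ (x₀ + y * Complex.I : ℂ) := by fun_prop
        simpa using (this.tendsto 0).mono_left nhdsWithin_le_nhds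
      · filter_upwards [self_mem_nhdsWithin] with y hy
        simpa using (ne_of_gt hy : y ≠ 0)
    refine hc.frequently (Eventually.frequently ?_)
    filter_upwards [(hc.mono_right nhdsWithin_le_nhds).eventually hSS', self_mem_nhdsWithin]
      with y h1 hy
    have him : 0 < (x₀ + y * Complex.I : ℂ).im := by simpa using hy
    rw [h1 him, hS _ him]
    exact Complex.exp_ne_zero _
  obtain ⟨n, g, C, hg⟩ := hS'.exists_log_norm_eq hfreq
  obtain ⟨ε, hε, hball⟩ := Metric.eventually_nhds_iff_ball.1 (hg.and hSS')
  set r := min (ε / 2) (1 / 2)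
  have hr : 0 < r := by positivity
  have hr2 : 2 * r ≤ ε := by linarith [(min_le_left _ _ : r ≤ ε / 2)]
  have hG : ∀ z ∈ Metric.ball (x₀ : ℂ) (2 * r),
      ContinuousAt (fun w ↦ Real.log ‖g w‖) z ∧ |Real.log ‖g z‖| ≤ C ∧
      (0 < z.im → Real.log ‖S z‖ = n * Real.log ‖z - x₀‖ + Real.log ‖g z‖) := by
    intro z hz
    obtain ⟨⟨h1, h2, h3⟩, h4⟩ := hball z (Metric.ball_subset_ball hr2 hz)
    refine ⟨h1, h2, fun him ↦ ?_⟩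
    rw [← h4 him]
    exact h3 fun h ↦ by simp [h] at him
  have hmem {x : ℝ} (hx : x ∈ Ioo (x₀ - r) (x₀ + r)) :
      (x : ℂ) ∈ Metric.ball (x₀ : ℂ) (2 * r) := by
    rw [Metric.mem_ball, dist_eq_norm, ← Complex.ofReal_sub, Complex.norm_real, Real.norm_eq_abs,
      abs_lt]
    constructor <;> linarith [hx.1, hx.2]
  have hgi : IntegrableOn (fun x : ℝ ↦ Real.log ‖g x‖) (Ioo (x₀ - r) (x₀ + r)) := by
    refine Integrable.of_bound (C := C) ?_ ?_
    · refine ContinuousOn.aestronglyMeasurable (fun x hx ↦ ?_) measurableSet_Ioo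
      exact (ContinuousAt.comp (f := fun x : ℝ ↦ (x : ℂ)) (hG _ (hmem hx)).1
        Complex.continuous_ofReal.continuousAt).continuousWithinAt
    · filter_upwards [ae_restrict_mem (measurableSet_Ioo (a := x₀ - r) (b := x₀ + r))] with x hx
      exact (hG _ (hmem hx)).2.1
  refine ⟨r, hr, restrict_Ioo_eq_of_forall_integral μ ν hμs hνs
    (h := fun x ↦ -(n * Real.log |x - x₀| + Real.log ‖g x‖))
    (((integrableOn_log_abs_sub x₀ _ _).const_mul _).add hgi).neg fun φ hφ h0 ↦ ?_⟩
  have hs : HasCompactSupport φ := HasCompactSupport.intro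
    (isCompact_Icc (a := x₀ - r) (b := x₀ + r)) fun x hx ↦ h0 x fun h ↦ hx (Ioo_subset_Icc_self h)
  have hlogS {y : ℝ} (hy : 0 < y) (x : ℝ) : φ x * Real.log ‖S (x + y * Complex.I)‖ =
      -π⁻¹ * (φ x * ∫ t, weightedPoisson y x t ∂μ - φ x * ∫ t, weightedPoisson y x t ∂ν) := by
    have him : 0 < (x + y * Complex.I : ℂ).im := by simpa using hy
    rw [hS _ him, log_norm_exp_kernel μ ν him]
    simp only [Complex.add_im, Complex.ofReal_im, Complex.mul_im, Complex.I_im, Complex.I_re,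
      Complex.ofReal_re, Complex.add_re, Complex.mul_re, mul_zero, mul_one, zero_add, add_zero,
      sub_zero]
    ring
  have hint (ρ : Measure ℝ) [IsFiniteMeasure ρ] {y : ℝ} (hy : 0 < y) :
      Integrable fun x ↦ φ x * ∫ t, weightedPoisson y x t ∂ρ := by
    simpa only [Function.uncurry, integral_const_mul] using
      (integrable_mul_weightedPoisson ρ hφ hs hy).integral_prod_left
  have hlim := tendsto_integral_mul_log_norm (F := fun z ↦ Real.log ‖S z‖) (min_le_right _ _) hr
    hG hφ h0 fun y hy ↦ by
      simp only [hlogS hy]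
      exact ((hint μ hy).sub (hint ν hy)).const_mul _
  have hlim2 := ((tendsto_integral_integral_weightedPoisson μ hφ hs).sub
    (tendsto_integral_integral_weightedPoisson ν hφ hs)).const_mul (-π⁻¹)
  have heq := tendsto_nhds_unique hlim (hlim2.congr' (by
    filter_upwards [self_mem_nhdsWithin] with y hy
    simp only [hlogS hy]
    rw [integral_const_mul, integral_sub (hint μ hy) (hint ν hy)]))
  simp only [mul_neg]
  rw [integral_neg, heq]
  have := Real.pi_ne_zero
  field_simp

/-- **A singular inner function with meromorphic boundary behaviour is trivial.**
A real bounded measure `dE` on `ℝ` is encoded as the difference `μ - ν` of two finite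
positive measures, each singular with respect to Lebesgue measure.  If
`S(z) = exp((i/π) ∫ (1+tz)/(t-z) dE(t))` on the upper half-plane admits a meromorphic
extension to a neighbourhood of every point of `ℝ`, then `dE = 0`, i.e. `μ = ν`. -/
theorem stmt7 (μ ν : Measure ℝ) [IsFiniteMeasure μ] [IsFiniteMeasure ν]
    (hμs : μ ⟂ₘ (volume : Measure ℝ)) (hνs : ν ⟂ₘ (volume : Measure ℝ))
    (S : ℂ → ℂ)
    (hS : ∀ z : ℂ, 0 < z.im → S z =
      Complex.exp ((Complex.I / (π : ℂ)) *
        ((∫ t : ℝ, (1 + (t : ℂ) * z) / ((t : ℂ) - z) ∂μ) -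
         (∫ t : ℝ, (1 + (t : ℂ) * z) / ((t : ℂ) - z) ∂ν))))
    (hmero : ∀ x : ℝ, ∃ U ∈ nhds (x : ℂ), ∃ S' : ℂ → ℂ,
      MeromorphicOn S' U ∧ ∀ z ∈ U, 0 < z.im → S' z = S z) :
    μ = ν := by
  have hloc (x : ℝ) : ∃ r > 0,
      μ.restrict (Ioo (x - r) (x + r)) = ν.restrict (Ioo (x - r) (x + r)) := by
    obtain ⟨U, hU, S', hS', hSS'⟩ := hmero x
    exact exists_restrict_Ioo_eq μ ν hμs hνs hS (hS' x (mem_of_mem_nhds hU))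
      (Filter.mem_of_superset hU hSS')
  choose r hr h using hloc
  obtain ⟨s, hs, hcover⟩ := TopologicalSpace.countable_cover_nhds
    (f := fun x ↦ Ioo (x - r x) (x + r x))
    fun x ↦ Ioo_mem_nhds (by linarith [hr x]) (by linarith [hr x])
  rw [← Measure.restrict_univ (μ := μ), ← Measure.restrict_univ (μ := ν), ← hcover]
  exact (Measure.restrict_biUnion_congr hs).2 fun x _ ↦ h x
end
end

section
/- Let dE be a real measure on ℝ such that dE(t)/(1+t²) is a bounded measure, and define the Poisson extension s(x+iy) = (1/π) ∫_ℝ (y/((t-x)² + y²)) dE(t) for y > 0. Then for every continuous compactly supported function f : ℝ → ℝ, ∫_ℝ f(t) dE(t) = lim_{y→0⁺} ∫_ℝ s(t+iy) f(t) dt. -/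
open MeasureTheory Complex Real Filter

noncomputable section

/-- The Poisson extension of the real measure `dE = μ - ν` to the upper half-plane:
`s(x+iy) = (1/π) ∫ y/((t-x)² + y²) dE(t)`. -/
def poissonExt (μ ν : Measure ℝ) (x y : ℝ) : ℝ :=
  (1 / π) * ((∫ t : ℝ, y / ((t - x) ^ 2 + y ^ 2) ∂μ) -
             (∫ t : ℝ, y / ((t - x) ^ 2 + y ^ 2) ∂ν))

/-- A measure integrating `(1 + t²)⁻¹` is finite near every point. -/
theorem isLocallyFiniteMeasure_of_integrable_inv_one_add_sq {μ : Measure ℝ}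
    (hμ : Integrable (fun t : ℝ => (1 + t ^ 2)⁻¹) μ) : IsLocallyFiniteMeasure μ := by
  refine ⟨fun x => ?_⟩
  have hx : (0 : ℝ) < (1 + x ^ 2)⁻¹ := by positivity
  refine ⟨{t | (1 + x ^ 2)⁻¹ / 2 < (1 + t ^ 2)⁻¹}, ?_, hμ.measure_gt_lt_top (half_pos hx)⟩
  have hc : Continuous fun t : ℝ => (1 + t ^ 2)⁻¹ :=
    Continuous.inv₀ (by fun_prop) fun t => by positivity
  exact (isOpen_lt continuous_const hc).mem_nhds (half_lt_self hx)

/-- Rescaling a Poisson integral to the kernel `(1 + s²)⁻¹`. -/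
theorem integral_poisson_kernel_mul (f : ℝ → ℝ) (t : ℝ) {y : ℝ} (hy : 0 < y) :
    ∫ x : ℝ, y / ((t - x) ^ 2 + y ^ 2) * f x = ∫ s : ℝ, (1 + s ^ 2)⁻¹ * f (t + y * s) := by
  have h₁ := Measure.integral_comp_mul_left
    (fun u : ℝ => y / ((t - (t + u)) ^ 2 + y ^ 2) * f (t + u)) y
  rw [integral_add_left_eq_self (fun x : ℝ => y / ((t - x) ^ 2 + y ^ 2) * f x) t,
    abs_of_pos (inv_pos.mpr hy), smul_eq_mul, ← div_eq_inv_mul, eq_div_iff hy.ne',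
    ← integral_mul_const] at h₁
  rw [← h₁]
  refine integral_congr_ae (Eventually.of_forall fun s => ?_)
  have : (0 : ℝ) < 1 + s ^ 2 := by positivity
  have h₂ : (t - (t + y * s)) ^ 2 + y ^ 2 = y ^ 2 * (1 + s ^ 2) := by ring
  simp only [h₂]
  field_simp

theorem integral_poisson_kernel (t : ℝ) {y : ℝ} (hy : 0 < y) :
    ∫ x : ℝ, y / ((t - x) ^ 2 + y ^ 2) = π := by
  simpa using integral_poisson_kernel_mul (fun _ => 1) t hy

theorem integrable_poisson_kernel (t : ℝ) {y : ℝ} (hy : 0 < y) :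
    Integrable fun x : ℝ => y / ((t - x) ^ 2 + y ^ 2) :=
  Integrable.of_integral_ne_zero (by rw [integral_poisson_kernel t hy]; exact Real.pi_ne_zero)

/-- The Poisson kernel against a function of decay `(1 + x²)⁻¹`. -/
theorem norm_poisson_kernel_mul_le {t x y a M : ℝ} (hy : 0 < y) (hM : (1 + x ^ 2) * |a| ≤ M) :
    ‖y / ((t - x) ^ 2 + y ^ 2) * a‖ ≤
      (1 + t ^ 2)⁻¹ * (2 * M * (y / ((t - x) ^ 2 + y ^ 2)) + 2 * y * |a|) := by
  have hD : 0 < (t - x) ^ 2 + y ^ 2 := by positivity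
  have ht : 0 < 1 + t ^ 2 := by positivity
  rw [norm_mul, Real.norm_eq_abs, Real.norm_eq_abs, abs_of_pos (by positivity),
    ← div_eq_inv_mul, le_div_iff₀ ht]
  have h₁ : 1 + t ^ 2 ≤ 2 * (1 + x ^ 2) + 2 * (t - x) ^ 2 := by
    nlinarith [sq_nonneg (t - 2 * x)]
  have h₂ : y / ((t - x) ^ 2 + y ^ 2) * (t - x) ^ 2 ≤ y := by
    rw [div_mul_eq_mul_div, div_le_iff₀ hD]
    exact mul_le_mul_of_nonneg_left (by nlinarith) hy.le
  have hk : 0 < y / ((t - x) ^ 2 + y ^ 2) := by positivity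
  calc y / ((t - x) ^ 2 + y ^ 2) * |a| * (1 + t ^ 2)
      ≤ y / ((t - x) ^ 2 + y ^ 2) * |a| * (2 * (1 + x ^ 2) + 2 * (t - x) ^ 2) := by gcongr
    _ = 2 * ((1 + x ^ 2) * |a|) * (y / ((t - x) ^ 2 + y ^ 2)) +
        2 * (y / ((t - x) ^ 2 + y ^ 2) * (t - x) ^ 2) * |a| := by ring
    _ ≤ 2 * M * (y / ((t - x) ^ 2 + y ^ 2)) + 2 * y * |a| := by gcongr

theorem exists_one_add_sq_mul_abs_le {f : ℝ → ℝ} (hf : Continuous f) (hfc : HasCompactSupport f) :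
    ∃ M, ∀ x, (1 + x ^ 2) * |f x| ≤ M := by
  obtain ⟨M, hM⟩ := (hfc.mul_left (f := fun x : ℝ => 1 + x ^ 2)).exists_bound_of_continuous
    (by fun_prop)
  refine ⟨M, fun x => ?_⟩
  have := hM x
  rwa [Pi.mul_apply, Real.norm_eq_abs, abs_mul, abs_of_pos (by positivity)] at this

/-- Poisson integrals of `f` are `O((1 + t²)⁻¹)`, uniformly in `0 < y ≤ 1`. -/
theorem norm_integral_poisson_kernel_mul_le {f : ℝ → ℝ} (hf : Integrable f) {M : ℝ}
    (hM : ∀ x, (1 + x ^ 2) * |f x| ≤ M) (t : ℝ) {y : ℝ} (hy : 0 < y) (hy1 : y ≤ 1) :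
    ‖∫ x : ℝ, y / ((t - x) ^ 2 + y ^ 2) * f x‖ ≤
      (2 * M * π + 2 * ∫ x : ℝ, |f x|) * (1 + t ^ 2)⁻¹ := by
  have hk := (integrable_poisson_kernel t hy).const_mul (2 * M)
  have hfa := hf.abs.const_mul (2 * y)
  refine (norm_integral_le_of_norm_le ((hk.add hfa).const_mul (1 + t ^ 2)⁻¹)
    (Eventually.of_forall fun x => norm_poisson_kernel_mul_le hy (hM x))).trans ?_
  have h0 : 0 ≤ ∫ x : ℝ, |f x| := integral_nonneg fun x => abs_nonneg _
  have ht : 0 < (1 + t ^ 2)⁻¹ := by positivity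
  rw [integral_const_mul]
  simp only [Pi.add_apply]
  rw [integral_add hk hfa, integral_const_mul, integral_const_mul,
    integral_poisson_kernel t hy, mul_comm]
  refine mul_le_mul_of_nonneg_right ?_ ht.le
  nlinarith

/-- Joint integrability for Fubini's theorem. -/
theorem integrable_poisson_kernel_mul_prod {μ : Measure ℝ} [SFinite μ]
    (hμ : Integrable (fun t : ℝ => (1 + t ^ 2)⁻¹) μ) {f : ℝ → ℝ} (hf : Continuous f)
    (hfc : HasCompactSupport f) {y : ℝ} (hy : 0 < y) :
    Integrable (fun p : ℝ × ℝ => y / ((p.2 - p.1) ^ 2 + y ^ 2) * f p.1) (volume.prod μ) := by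
  have hint : Integrable (fun x : ℝ => 2 * ((1 + x ^ 2) * |f x|) * y⁻¹ + 2 * y * |f x|) := by
    refine Continuous.integrable_of_hasCompactSupport (by fun_prop) (hfc.mono fun x hx => ?_)
    contrapose! hx
    simp only [Function.mem_support, not_not] at hx ⊢
    simp [hx]
  refine (hint.mul_prod hμ).mono' (Continuous.aestronglyMeasurable ?_)
    (Eventually.of_forall fun p => ?_)
  · exact (continuous_const.div (by fun_prop) fun p => by positivity).mul (by fun_prop)
  · refine (norm_poisson_kernel_mul_le hy le_rfl).trans ?_
    rw [mul_comm]
    have h : y / ((p.2 - p.1) ^ 2 + y ^ 2) ≤ y⁻¹ := by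
      rw [div_le_iff₀ (by positivity), ← div_eq_inv_mul, le_div_iff₀ hy]
      nlinarith [sq_nonneg (p.2 - p.1)]
    gcongr

theorem tendsto_integral_poisson_kernel_mul {f : ℝ → ℝ} (hf : Continuous f)
    (hfc : HasCompactSupport f) (t : ℝ) :
    Tendsto (fun y : ℝ => ∫ x : ℝ, y / ((t - x) ^ 2 + y ^ 2) * f x)
      (nhdsWithin 0 (Set.Ioi 0)) (nhds (π * f t)) := by
  obtain ⟨C, hC⟩ := hfc.exists_bound_of_continuous hf
  have hlim : Tendsto (fun y : ℝ => ∫ s : ℝ, (1 + s ^ 2)⁻¹ * f (t + y * s))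
      (nhdsWithin 0 (Set.Ioi 0)) (nhds (∫ s : ℝ, (1 + s ^ 2)⁻¹ * f t)) := by
    refine tendsto_integral_filter_of_dominated_convergence (fun s => (1 + s ^ 2)⁻¹ * C)
      (Eventually.of_forall fun y => Continuous.aestronglyMeasurable ?_)
      (Eventually.of_forall fun y => Eventually.of_forall fun s => ?_)
      (integrable_inv_one_add_sq.mul_const C) (Eventually.of_forall fun s => ?_)
    · exact (Continuous.inv₀ (by fun_prop) fun s => by positivity).mul (by fun_prop)
    · rw [norm_mul, Real.norm_of_nonneg (by positivity)]
      exact mul_le_mul_of_nonneg_left (hC _) (by positivity)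
    · have hcont : Continuous fun y : ℝ => (1 + s ^ 2)⁻¹ * f (t + y * s) := by fun_prop
      simpa using (hcont.tendsto 0).mono_left nhdsWithin_le_nhds
  rw [integral_mul_const, integral_univ_inv_one_add_sq] at hlim
  refine hlim.congr' ?_
  filter_upwards [self_mem_nhdsWithin] with y hy
  exact (integral_poisson_kernel_mul f t hy).symm

/-- Weak convergence of the Poisson integrals of a single positive measure. -/
theorem tendsto_integral_poisson_integral_mul {μ : Measure ℝ}
    (hμ : Integrable (fun t : ℝ => (1 + t ^ 2)⁻¹) μ) {f : ℝ → ℝ} (hf : Continuous f)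
    (hfc : HasCompactSupport f) :
    Tendsto (fun y : ℝ => ∫ x : ℝ, ∫ t : ℝ, y / ((t - x) ^ 2 + y ^ 2) * f x ∂μ)
      (nhdsWithin 0 (Set.Ioi 0)) (nhds (π * ∫ t : ℝ, f t ∂μ)) := by
  have := isLocallyFiniteMeasure_of_integrable_inv_one_add_sq hμ
  obtain ⟨M, hM⟩ := exists_one_add_sq_mul_abs_le hf hfc
  rw [← integral_const_mul]
  have hlim : Tendsto (fun y : ℝ => ∫ t : ℝ, ∫ x : ℝ, y / ((t - x) ^ 2 + y ^ 2) * f x ∂volume ∂μ)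
      (nhdsWithin 0 (Set.Ioi 0)) (nhds (∫ t : ℝ, π * f t ∂μ)) := by
    refine tendsto_integral_filter_of_dominated_convergence
      (fun t => (2 * M * π + 2 * ∫ x : ℝ, |f x|) * (1 + t ^ 2)⁻¹) ?_ ?_ (hμ.const_mul _)
      (Eventually.of_forall (tendsto_integral_poisson_kernel_mul hf hfc))
    · filter_upwards [self_mem_nhdsWithin] with y hy
      exact (integrable_poisson_kernel_mul_prod hμ hf hfc hy).integral_prod_right.aestronglyMeasurable
    · filter_upwards [Ioc_mem_nhdsGT (zero_lt_one (α := ℝ))] with y hy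
      exact Eventually.of_forall fun t => norm_integral_poisson_kernel_mul_le
        (hf.integrable_of_hasCompactSupport hfc) hM t hy.1 hy.2
  refine hlim.congr' ?_
  filter_upwards [self_mem_nhdsWithin] with y hy
  exact (integral_integral_swap (integrable_poisson_kernel_mul_prod hμ hf hfc hy)).symm

/-- **The Poisson extension recovers the measure weakly as `y → 0⁺`.**
If `dE = μ - ν` is a real measure on `ℝ` with `dE(t)/(1+t²)` bounded, then for every
continuous compactly supported `f`, `∫ f dE = lim_{y→0⁺} ∫ s(t+iy) f(t) dt`. -/
theorem stmt8 (μ ν : Measure ℝ)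
    (hμ : Integrable (fun t : ℝ => (1 + t ^ 2)⁻¹) μ)
    (hν : Integrable (fun t : ℝ => (1 + t ^ 2)⁻¹) ν)
    (f : ℝ → ℝ) (hf : Continuous f) (hfc : HasCompactSupport f) :
    Tendsto (fun y : ℝ => ∫ t : ℝ, poissonExt μ ν t y * f t)
      (nhdsWithin 0 (Set.Ioi 0))
      (nhds ((∫ t : ℝ, f t ∂μ) - ∫ t : ℝ, f t ∂ν)) := by
  have := isLocallyFiniteMeasure_of_integrable_inv_one_add_sq hμ
  have := isLocallyFiniteMeasure_of_integrable_inv_one_add_sq hν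
  have hlim := ((tendsto_integral_poisson_integral_mul hμ hf hfc).sub
    (tendsto_integral_poisson_integral_mul hν hf hfc)).const_mul (1 / π)
  rw [← mul_sub, ← mul_assoc, one_div_mul_cancel Real.pi_ne_zero, one_mul] at hlim
  refine hlim.congr' ?_
  filter_upwards [self_mem_nhdsWithin] with y hy
  rw [← integral_sub (integrable_poisson_kernel_mul_prod hμ hf hfc hy).integral_prod_left
    (integrable_poisson_kernel_mul_prod hν hf hfc hy).integral_prod_left, ← integral_const_mul]
  refine integral_congr_ae (Eventually.of_forall fun x => ?_)
  simp only [poissonExt, integral_mul_const]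
  ring
end
end

section
/- Let a < b, M > 0, A, B > 0 and 0 < ε ≤ 1. Let W be holomorphic and bounded on the band {a < Im z < b} with continuous extension to the closure, satisfying |W(z)| ≤ B on Im z = b, |W(z)| ≤ A on {Im z = a, |Re z| > M}, and |W(z)| ≤ εA on {Im z = a, |Re z| ≤ M}. Then for every z with Im z = (1-t)a + tb, t ∈ (0,1), we have |W(z)| ≤ ε^{f(z)} A^{1-t} B^t, where f(z) = (1/π) arg((e^{πM/(b-a)} - e^{π(z-ia)/(b-a)})/(e^{-πM/(b-a)} - e^{π(z-ia)/(b-a)})). -/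
open Complex Real

noncomputable section

/-- The harmonic-measure function
`f(z) = (1/π) arg((e^{πM/(b-a)} - e^{π(z-ia)/(b-a)}) / (e^{-πM/(b-a)} - e^{π(z-ia)/(b-a)}))`
of the boundary segment `{Im z = a, |Re z| < M}` in the band `{a < Im z < b}`. -/
def fband (a b M : ℝ) (z : ℂ) : ℝ :=
  (1 / π) * Complex.arg
    ((Complex.exp ((π * M / (b - a) : ℝ) : ℂ) -
        Complex.exp ((π : ℂ) * (z - (a : ℂ) * Complex.I) / ((b : ℂ) - (a : ℂ)))) /
     (Complex.exp ((-(π * M) / (b - a) : ℝ) : ℂ) -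
        Complex.exp ((π : ℂ) * (z - (a : ℂ) * Complex.I) / ((b : ℂ) - (a : ℂ)))))

/-- The conformal map of the band `{a < Im z < b}` onto the upper half-plane. -/
def bandExp (a b : ℝ) (z : ℂ) : ℂ :=
  Complex.exp ((π : ℂ) * (z - (a : ℂ) * Complex.I) / ((b : ℂ) - (a : ℂ)))

lemma bandExp_exponent_eq (a b : ℝ) (z : ℂ) :
    (π : ℂ) * (z - (a : ℂ) * Complex.I) / ((b : ℂ) - (a : ℂ)) =
      ((π * z.re / (b - a) : ℝ) : ℂ) + ((π * (z.im - a) / (b - a) : ℝ) : ℂ) * Complex.I := by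
  conv_lhs => rw [← Complex.re_add_im z]
  push_cast
  ring

lemma bandExp_im (a b : ℝ) (z : ℂ) :
    (bandExp a b z).im =
      Real.exp (π * z.re / (b - a)) * Real.sin (π * (z.im - a) / (b - a)) := by
  rw [bandExp, bandExp_exponent_eq, Complex.exp_im]
  simp [-Complex.ofReal_mul, -Complex.ofReal_div]

lemma bandExp_re (a b : ℝ) (z : ℂ) :
    (bandExp a b z).re =
      Real.exp (π * z.re / (b - a)) * Real.cos (π * (z.im - a) / (b - a)) := by
  rw [bandExp, bandExp_exponent_eq, Complex.exp_re]
  simp [-Complex.ofReal_mul, -Complex.ofReal_div]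

lemma bandExp_im_pos {a b : ℝ} {z : ℂ} (hab : a < b) (ha : a < z.im) (hb : z.im < b) :
    0 < (bandExp a b z).im := by
  have h : 0 < b - a := sub_pos.2 hab
  rw [bandExp_im]
  refine mul_pos (Real.exp_pos _) (Real.sin_pos_of_pos_of_lt_pi ?_ ?_)
  · exact div_pos (mul_pos Real.pi_pos (by linarith)) h
  · rw [div_lt_iff₀ h]
    exact mul_lt_mul_of_pos_left (by linarith) Real.pi_pos

lemma bandExp_im_nonneg {a b : ℝ} {z : ℂ} (hab : a < b) (ha : a ≤ z.im) (hb : z.im ≤ b) :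
    0 ≤ (bandExp a b z).im := by
  have h : 0 < b - a := sub_pos.2 hab
  rw [bandExp_im]
  refine mul_nonneg (Real.exp_pos _).le (Real.sin_nonneg_of_nonneg_of_le_pi ?_ ?_)
  · exact div_nonneg (mul_nonneg Real.pi_pos.le (by linarith)) h.le
  · rw [div_le_iff₀ h]
    exact mul_le_mul_of_nonneg_left (by linarith) Real.pi_pos.le

lemma differentiable_bandExp (a b : ℝ) : Differentiable ℂ (bandExp a b) := by
  unfold bandExp
  fun_prop

lemma bandExp_of_im_eq_left {a b : ℝ} {z : ℂ} (hz : z.im = a) :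
    bandExp a b z = ((Real.exp (π * z.re / (b - a)) : ℝ) : ℂ) := by
  apply Complex.ext <;> simp [bandExp_re, bandExp_im, hz, -Complex.ofReal_exp]

lemma bandExp_of_im_eq_right {a b : ℝ} {z : ℂ} (hab : a < b) (hz : z.im = b) :
    bandExp a b z = ((-Real.exp (π * z.re / (b - a)) : ℝ) : ℂ) := by
  have h : b - a ≠ 0 := (sub_pos.2 hab).ne'
  apply Complex.ext <;> simp [bandExp_re, bandExp_im, hz, h, -Complex.ofReal_exp]

lemma ofReal_sub_ne_zero_of_im_pos {q : ℝ} {u : ℂ} (hu : 0 < u.im) : (q : ℂ) - u ≠ 0 := by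
  intro h
  have := congrArg Complex.im h
  simp at this
  linarith

lemma im_sub_div_sub_pos {p q : ℝ} {u : ℂ} (hpq : q < p) (hu : 0 < u.im) :
    0 < (((p : ℂ) - u) / ((q : ℂ) - u)).im := by
  have h0 := Complex.normSq_pos.2 (ofReal_sub_ne_zero_of_im_pos (q := q) hu)
  have : (((p : ℂ) - u) / ((q : ℂ) - u)).im = (p - q) * u.im / Complex.normSq ((q : ℂ) - u) := by
    rw [Complex.div_im]
    simp
    ring
  rw [this]
  exact div_pos (mul_pos (sub_pos.2 hpq) hu) h0

lemma arg_nonneg_le_of_im_le_mul_re {m : ℂ} {r : ℝ} (hre : 0 < m.re) (hr : 0 ≤ r)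
    (h : m.im ≤ r * m.re) : m.arg ≤ r := by
  by_contra! hlt
  have h2 : m.arg < π / 2 := (abs_lt.1 (Complex.abs_arg_lt_pi_div_two_iff.2 (Or.inl hre))).2
  have h3 := Real.lt_tan (hr.trans_lt hlt) h2
  rw [Complex.tan_arg] at h3
  have := (div_le_iff₀ hre).2 h
  linarith

/-- For real `s` outside `(q, p)`, the regularized harmonic measure of `[q + η, p - η]`, evaluated
at height `η ^ 2` above `s`, is at most `η / π`. -/
lemma arg_sub_div_sub_le {p q η s : ℝ} (hη : 0 < η) (hηpq : 2 * η < p - q)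
    (hs : s ≤ q ∨ p ≤ s) :
    ((((p - η : ℝ) : ℂ) - (s + ((η ^ 2 : ℝ) : ℂ) * Complex.I)) /
      (((q + η : ℝ) : ℂ) - (s + ((η ^ 2 : ℝ) : ℂ) * Complex.I))).arg ≤ η := by
  set u : ℂ := s + ((η ^ 2 : ℝ) : ℂ) * Complex.I with hu
  have hure : u.re = s := by simp [hu, -Complex.ofReal_pow]
  have huim : u.im = η ^ 2 := by simp [hu, -Complex.ofReal_pow]
  have hupos : 0 < u.im := by rw [huim]; positivity
  have h0 := Complex.normSq_pos.2 (ofReal_sub_ne_zero_of_im_pos (q := q + η) hupos)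
  have him : ((((p - η : ℝ) : ℂ) - u) / (((q + η : ℝ) : ℂ) - u)).im =
      ((p - η) - (q + η)) * η ^ 2 / Complex.normSq (((q + η : ℝ) : ℂ) - u) := by
    rw [Complex.div_im]
    simp only [Complex.sub_im, Complex.sub_re, Complex.ofReal_re, Complex.ofReal_im, hure, huim]
    ring
  have hre : ((((p - η : ℝ) : ℂ) - u) / (((q + η : ℝ) : ℂ) - u)).re =
      ((p - η - s) * (q + η - s) + η ^ 4) / Complex.normSq (((q + η : ℝ) : ℂ) - u) := by
    rw [Complex.div_re]
    simp only [Complex.sub_im, Complex.sub_re, Complex.ofReal_re, Complex.ofReal_im, hure, huim]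
    ring
  have key : η * (p - q - η) ≤ (p - η - s) * (q + η - s) := by
    rcases hs with hs | hs
    · nlinarith [mul_nonneg (sub_nonneg.2 hs) (sub_nonneg.2 hs)]
    · nlinarith [mul_nonneg (sub_nonneg.2 hs) (sub_nonneg.2 hs)]
  have hη4 : 0 < η ^ 4 := by positivity
  apply arg_nonneg_le_of_im_le_mul_re _ hη.le
  · rw [him, hre, ← mul_div_assoc]
    refine div_le_div_of_nonneg_right ?_ h0.le
    nlinarith [mul_le_mul_of_nonneg_left key hη.le, pow_pos hη 3, mul_pos hη hη4]
  · rw [hre]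
    refine div_pos ?_ h0
    nlinarith

/-- The argument of `fband` on the slightly shortened segment, evaluated slightly above the real
line of the half-plane, so that it is continuous up to the boundary. -/
def bandRatio (a b p q η : ℝ) (z : ℂ) : ℂ :=
  (((p - η : ℝ) : ℂ) - (bandExp a b z + ((η ^ 2 : ℝ) : ℂ) * Complex.I)) /
    (((q + η : ℝ) : ℂ) - (bandExp a b z + ((η ^ 2 : ℝ) : ℂ) * Complex.I))

lemma bandExp_add_im_pos {a b η : ℝ} {z : ℂ} (hab : a < b) (hη : 0 < η) (ha : a ≤ z.im)
    (hb : z.im ≤ b) : 0 < (bandExp a b z + ((η ^ 2 : ℝ) : ℂ) * Complex.I).im := by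
  have h := bandExp_im_nonneg hab ha hb
  have : 0 < η ^ 2 := by positivity
  rw [Complex.add_im, Complex.im_ofReal_mul, Complex.I_im]
  linarith

lemma bandRatio_im_pos {a b p q η : ℝ} {z : ℂ} (hab : a < b) (hη : 0 < η)
    (hηpq : 2 * η < p - q) (ha : a ≤ z.im) (hb : z.im ≤ b) : 0 < (bandRatio a b p q η z).im :=
  im_sub_div_sub_pos (by linarith) (bandExp_add_im_pos hab hη ha hb)

lemma differentiableAt_log_bandRatio {a b p q η : ℝ} {z : ℂ} (hab : a < b) (hη : 0 < η)
    (hηpq : 2 * η < p - q) (ha : a ≤ z.im) (hb : z.im ≤ b) :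
    DifferentiableAt ℂ (fun z => Complex.log (bandRatio a b p q η z)) z := by
  have hE := differentiable_bandExp a b z
  refine DifferentiableAt.clog ?_ (Or.inr (bandRatio_im_pos hab hη hηpq ha hb).ne')
  unfold bandRatio
  exact DifferentiableAt.div (by fun_prop) (by fun_prop)
    (ofReal_sub_ne_zero_of_im_pos (bandExp_add_im_pos hab hη ha hb))

/-- A complex logarithm of `A ^ (1 - t) * B ^ t * ε ^ f` for the regularized `f`. -/
def bandLog (a b p q η A B ε : ℝ) (z : ℂ) : ℂ :=
  (Real.log A : ℂ) + ((Real.log B - Real.log A : ℝ) : ℂ) *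
      (-Complex.I * (z - (a : ℂ) * Complex.I) / ((b - a : ℝ) : ℂ)) -
    ((Real.log ε / π : ℝ) : ℂ) * (Complex.I * Complex.log (bandRatio a b p q η z))

lemma bandLog_re (a b p q η A B ε : ℝ) (z : ℂ) :
    (bandLog a b p q η A B ε z).re =
      Real.log A + (Real.log B - Real.log A) * ((z.im - a) / (b - a)) +
        Real.log ε / π * (bandRatio a b p q η z).arg := by
  rw [bandLog, Complex.sub_re, Complex.add_re, Complex.re_ofReal_mul, Complex.re_ofReal_mul,
    Complex.div_ofReal_re, Complex.I_mul_re, Complex.log_im]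
  simp

lemma norm_le_exp_bandLog_re {a b p q η A B ε : ℝ} (hab : a < b) (hη : 0 < η)
    (hηpq : 2 * η < p - q) (hq : 0 < q) (hA : 0 < A) (hB : 0 < B) (hε0 : 0 < ε) (hε1 : ε ≤ 1)
    {W : ℂ → ℂ} (hW : DifferentiableOn ℂ W {z : ℂ | a < z.im ∧ z.im < b})
    (hWbdd : ∃ C : ℝ, ∀ z : ℂ, a < z.im → z.im < b → ‖W z‖ ≤ C)
    (hWc : ContinuousOn W {z : ℂ | a ≤ z.im ∧ z.im ≤ b})
    (hlineb : ∀ z : ℂ, z.im = b → ‖W z‖ ≤ B)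
    (hlinea : ∀ z : ℂ, z.im = a → ‖W z‖ ≤ A)
    (hlinea_in : ∀ z : ℂ, z.im = a → Real.exp (π * z.re / (b - a)) ∈ Set.Ioo q p → ‖W z‖ ≤ ε * A)
    {z : ℂ} (ha : a < z.im) (hb : z.im < b) :
    ‖W z‖ ≤ Real.exp ((bandLog a b p q η A B ε z).re - Real.log ε / π * η) := by
  have hba : 0 < b - a := sub_pos.2 hab
  have hπ := Real.pi_pos
  have hc : Real.log ε / π ≤ 0 := div_nonpos_of_nonpos_of_nonneg (Real.log_nonpos hε0.le hε1) hπ.le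
  have hcπ : Real.log ε / π * π = Real.log ε := div_mul_cancel₀ _ hπ.ne'
  set L := bandLog a b p q η A B ε with hL
  set G : ℂ → ℂ := fun z => W z * Complex.exp (-L z) with hG
  have hGn : ∀ z, ‖G z‖ = ‖W z‖ * Real.exp (-(L z).re) := fun z => by
    simp [hG, Complex.norm_exp]
  have hLd : ∀ z : ℂ, a ≤ z.im → z.im ≤ b → DifferentiableAt ℂ L z := fun z h1 h2 => by
    have := differentiableAt_log_bandRatio hab hη hηpq h1 h2
    rw [hL]
    unfold bandLog
    fun_prop
  have hclos : closure (Complex.im ⁻¹' Set.Ioo a b) = {z : ℂ | a ≤ z.im ∧ z.im ≤ b} := by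
    rw [Complex.closure_preimage_im, closure_Ioo hab.ne]
    rfl
  have hGd : DiffContOnCl ℂ G (Complex.im ⁻¹' Set.Ioo a b) := by
    refine ⟨fun z hz => ?_, ?_⟩
    · exact (hW z hz).mul (hLd z hz.1.le hz.2.le).neg.cexp.differentiableWithinAt
    · rw [hclos]
      exact hWc.mul fun z hz => (hLd z hz.1 hz.2).neg.cexp.continuousAt.continuousWithinAt
  have hargle : ∀ z : ℂ, Real.log ε ≤ Real.log ε / π * (bandRatio a b p q η z).arg := fun z => by
    have := mul_le_mul_of_nonpos_left (Complex.arg_le_pi (bandRatio a b p q η z)) hc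
    rwa [hcπ] at this
  have hargout : ∀ (z : ℂ) (s : ℝ), bandExp a b z = s → s ≤ q ∨ p ≤ s →
      Real.log ε / π * η ≤ Real.log ε / π * (bandRatio a b p q η z).arg := fun z s hz hs => by
    refine mul_le_mul_of_nonpos_left ?_ hc
    rw [bandRatio, hz]
    exact arg_sub_div_sub_le hη hηpq hs
  have hbound : ∀ (z : ℂ) (x C : ℝ), 0 < x → ‖W z‖ ≤ x → Real.log x - (L z).re ≤ C →
      ‖G z‖ ≤ Real.exp C := fun z x C hx hWx hxC => by
    rw [hGn]
    calc ‖W z‖ * Real.exp (-(L z).re) ≤ Real.exp (Real.log x) * Real.exp (-(L z).re) := by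
          rw [Real.exp_log hx]; gcongr
      _ = Real.exp (Real.log x - (L z).re) := by rw [← Real.exp_add, sub_eq_add_neg]
      _ ≤ Real.exp C := Real.exp_le_exp.2 hxC
  have hcη : Real.log ε / π * η ≤ 0 := mul_nonpos_of_nonpos_of_nonneg hc hη.le
  have hfin : ‖G z‖ ≤ Real.exp (-(Real.log ε / π * η)) := by
    refine PhragmenLindelof.horizontal_strip hGd ⟨0, div_pos hπ hba, 0, ?_⟩ ?_ ?_ ha.le hb.le
    · obtain ⟨C, hC⟩ := hWbdd
      refine Asymptotics.IsBigO.of_bound (Real.exp (Real.log (max C 1) + |Real.log A| +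
        |Real.log B - Real.log A| - Real.log ε)) ?_
      filter_upwards [Filter.mem_inf_of_right (Filter.mem_principal_self _)] with z hz
      simp only [zero_mul, Real.exp_zero, norm_one, mul_one]
      refine hbound z (max C 1) _ (by positivity) ((hC z hz.1 hz.2).trans (le_max_left _ _)) ?_
      have h1 : |(z.im - a) / (b - a)| ≤ 1 := by
        rw [abs_of_nonneg (div_nonneg (by linarith [hz.1]) hba.le), div_le_one hba]
        linarith [hz.2]
      have h2 : |(Real.log B - Real.log A) * ((z.im - a) / (b - a))| ≤ |Real.log B - Real.log A| := by
        rw [abs_mul]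
        exact mul_le_of_le_one_right (abs_nonneg _) h1
      rw [hL, bandLog_re]
      linarith [hargle z, neg_abs_le (Real.log A), (abs_le.1 h2).1]
    · intro z hz
      have hRe : (L z).re = Real.log A + Real.log ε / π * (bandRatio a b p q η z).arg := by
        rw [hL, bandLog_re]; simp [hz]
      by_cases hs : Real.exp (π * z.re / (b - a)) ∈ Set.Ioo q p
      · refine hbound z _ _ (mul_pos hε0 hA) (hlinea_in z hz hs) ?_
        rw [hRe, Real.log_mul hε0.ne' hA.ne']
        linarith [hargle z]
      · refine hbound z _ _ hA (hlinea z hz) ?_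
        rw [Set.mem_Ioo, not_and_or, not_lt, not_lt] at hs
        rw [hRe]
        linarith [hargout z _ (bandExp_of_im_eq_left hz) hs]
    · intro z hz
      refine hbound z _ _ hB (hlineb z hz) ?_
      rw [hL, bandLog_re, hz, div_self hba.ne']
      linarith [hargout z _ (bandExp_of_im_eq_right hab hz)
        (Or.inl (by linarith [Real.exp_pos (π * z.re / (b - a))]))]
  rw [hGn, Real.exp_neg, ← div_eq_mul_inv, div_le_iff₀ (Real.exp_pos _), ← Real.exp_add] at hfin
  rwa [sub_eq_neg_add]

lemma tendsto_arg_bandRatio {a b p q : ℝ} {z : ℂ} (hpq : q < p) (hz : 0 < (bandExp a b z).im) :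
    Filter.Tendsto (fun η => (bandRatio a b p q η z).arg) (nhdsWithin 0 (Set.Ioi 0))
      (nhds (((p : ℂ) - bandExp a b z) / ((q : ℂ) - bandExp a b z)).arg) := by
  have h0 : bandRatio a b p q 0 z = ((p : ℂ) - bandExp a b z) / ((q : ℂ) - bandExp a b z) := by
    simp [bandRatio]
  have hc : ContinuousAt (fun η => bandRatio a b p q η z) 0 := by
    unfold bandRatio
    refine ContinuousAt.div (by fun_prop) (by fun_prop) ?_
    simpa using ofReal_sub_ne_zero_of_im_pos hz
  have hs : bandRatio a b p q 0 z ∈ Complex.slitPlane := by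
    rw [h0]
    exact Or.inr (im_sub_div_sub_pos hpq hz).ne'
  rw [← h0]
  exact (Complex.continuousAt_arg hs).tendsto.comp (hc.tendsto.mono_left nhdsWithin_le_nhds)

/-- **Quantified three-lines lemma with smallness on a segment of one boundary line.**
If `|W| ≤ B` on `Im z = b`, `|W| ≤ A` on `{Im z = a, |Re z| > M}` and `|W| ≤ εA` on
`{Im z = a, |Re z| ≤ M}`, then `|W(z)| ≤ ε^{f(z)} A^{1-t} B^t` on the line
`Im z = (1-t)a + tb`. -/
theorem stmt13 (a b M A B ε : ℝ) (hab : a < b) (hM : 0 < M) (hA : 0 < A) (hB : 0 < B)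
    (hε0 : 0 < ε) (hε1 : ε ≤ 1) (W : ℂ → ℂ)
    (hW : DifferentiableOn ℂ W {z : ℂ | a < z.im ∧ z.im < b})
    (hWbdd : ∃ C : ℝ, ∀ z : ℂ, a < z.im → z.im < b → ‖W z‖ ≤ C)
    (hWc : ContinuousOn W {z : ℂ | a ≤ z.im ∧ z.im ≤ b})
    (hlineb : ∀ z : ℂ, z.im = b → ‖W z‖ ≤ B)
    (hlinea_out : ∀ z : ℂ, z.im = a → M < |z.re| → ‖W z‖ ≤ A)
    (hlinea_in : ∀ z : ℂ, z.im = a → |z.re| ≤ M → ‖W z‖ ≤ ε * A) :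
    ∀ t ∈ Set.Ioo (0 : ℝ) 1, ∀ z : ℂ, z.im = (1 - t) * a + t * b →
      ‖W z‖ ≤ ε ^ fband a b M z * A ^ (1 - t) * B ^ t := by
  intro t ht z hz
  have hba : 0 < b - a := sub_pos.2 hab
  have ha : a < z.im := by rw [hz]; nlinarith [mul_pos ht.1 hba]
  have hb : z.im < b := by rw [hz]; nlinarith [mul_pos (sub_pos.2 ht.2) hba]
  have htz : (z.im - a) / (b - a) = t := by
    rw [hz, div_eq_iff hba.ne']
    ring
  set p := Real.exp (π * M / (b - a)) with hp
  set q := Real.exp (-(π * M) / (b - a)) with hq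
  have hπM : 0 < π * M := mul_pos Real.pi_pos hM
  have hpq : q < p := by
    rw [hp, hq, Real.exp_lt_exp]
    gcongr
    linarith
  have hlinea : ∀ z : ℂ, z.im = a → ‖W z‖ ≤ A := fun z hz => by
    rcases lt_or_ge M |z.re| with h | h
    · exact hlinea_out z hz h
    · exact (hlinea_in z hz h).trans (mul_le_of_le_one_left hA.le hε1)
  have hin : ∀ z : ℂ, z.im = a → Real.exp (π * z.re / (b - a)) ∈ Set.Ioo q p →
      ‖W z‖ ≤ ε * A := fun z hz hs => by
    refine hlinea_in z hz (abs_le.2 ?_)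
    rw [hp, hq, Set.mem_Ioo, Real.exp_lt_exp, Real.exp_lt_exp, div_lt_div_iff_of_pos_right hba,
      div_lt_div_iff_of_pos_right hba, ← mul_neg, mul_lt_mul_iff_right₀ Real.pi_pos,
      mul_lt_mul_iff_right₀ Real.pi_pos] at hs
    exact ⟨hs.1.le, hs.2.le⟩
  have hf : fband a b M z =
      1 / π * (((p : ℂ) - bandExp a b z) / ((q : ℂ) - bandExp a b z)).arg := by
    rw [fband, hp, hq, Complex.ofReal_exp, Complex.ofReal_exp, bandExp]
  have hrhs : ε ^ fband a b M z * A ^ (1 - t) * B ^ t =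
      Real.exp (Real.log A + (Real.log B - Real.log A) * t + Real.log ε / π *
        (((p : ℂ) - bandExp a b z) / ((q : ℂ) - bandExp a b z)).arg - Real.log ε / π * 0) := by
    rw [hf, Real.rpow_def_of_pos hε0, Real.rpow_def_of_pos hA, Real.rpow_def_of_pos hB,
      ← Real.exp_add, ← Real.exp_add]
    congr 1
    ring
  have hη : Filter.Tendsto (fun η : ℝ => η) (nhdsWithin 0 (Set.Ioi 0)) (nhds 0) :=
    Filter.tendsto_id.mono_left nhdsWithin_le_nhds
  have hlim := (Real.continuous_exp.tendsto _).comp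
    ((((tendsto_arg_bandRatio hpq (bandExp_im_pos hab ha hb)).const_mul
      (Real.log ε / π)).const_add (Real.log A + (Real.log B - Real.log A) * t)).sub
        (hη.const_mul (Real.log ε / π)))
  rw [hrhs]
  refine ge_of_tendsto hlim ?_
  filter_upwards [Ioo_mem_nhdsGT (show (0 : ℝ) < (p - q) / 2 by linarith)] with η hη
  have := norm_le_exp_bandLog_re (p := p) (q := q) hab hη.1 (by linarith [hη.2]) (Real.exp_pos _)
    hA hB hε0 hε1 hW hWbdd hWc hlineb hlinea hin ha hb
  rwa [bandLog_re, htz] at this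
end
end

section
/- Let a < b, M > 0, A > 0 and 0 < ε ≤ 1. Let W be holomorphic and bounded on the band {a < Im z < b} with continuous extension to the closure, satisfying |W(x+ia)| ≤ A and |W(x+ib)| ≤ A for |x| > M, and |W(x+ia)| ≤ εA and |W(x+ib)| ≤ εA for |x| ≤ M. Then for every z in the open band with |Re z| < M and t = (Im z - a)/(b-a), |W(z)| ≤ ε^{g} A where g = 1 - 4t · e^{-π(M-|Re z|)/(b-a)}/(1 - e^{-π(M-|Re z|)/(b-a)}), provided g ≥ 0. -/
open Complex Real

open Set Filter Topology

theorem Complex.arg_le_im_div_re {w : ℂ} (hre : 0 < w.re) (him : 0 ≤ w.im) :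
    w.arg ≤ w.im / w.re := by
  rw [← tan_arg]
  exact le_tan (arg_nonneg_iff.2 him) (arg_lt_pi_div_two_iff.2 (Or.inl hre))

theorem Complex.pi_sub_arg_le_im_div_neg_re {w : ℂ} (hre : w.re < 0) (him : 0 < w.im) :
    π - w.arg ≤ w.im / -w.re := by
  have h1 := arg_neg_eq_arg_sub_pi_of_im_pos him
  have h2 : (starRingEnd ℂ (-w)).arg = π - w.arg := by
    rw [arg_conj, if_neg, h1]
    · ring
    · rw [h1]
      linarith [arg_le_pi w, Real.pi_pos]
  have h3 := arg_le_im_div_re (w := starRingEnd ℂ (-w)) (by simpa using hre) (by simpa using him.le)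
  rw [h2] at h3
  simpa using h3

/-- The function `-coth (s / 2)`, mapping the strip `0 < Im s < π` conformally onto the upper
half-plane. -/
noncomputable def negCothHalf (s : ℂ) : ℂ := (1 + Complex.exp s) / (1 - Complex.exp s)

section negCothHalf

variable {s : ℂ}

theorem sin_im_pos_of_mem_strip (h0 : 0 < s.im) (hpi : s.im < π) : 0 < Real.sin s.im :=
  Real.sin_pos_of_pos_of_lt_pi h0 hpi

theorem one_sub_exp_ne_zero_of_mem_strip (h0 : 0 < s.im) (hpi : s.im < π) :
    1 - Complex.exp s ≠ 0 := by
  intro h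
  have := congrArg Complex.im h
  simp only [Complex.sub_im, Complex.one_im, Complex.exp_im, Complex.zero_im] at this
  nlinarith [mul_pos (Real.exp_pos s.re) (sin_im_pos_of_mem_strip h0 hpi)]

theorem exists_pos_negCothHalf_eq (h0 : 0 < s.im) (hpi : s.im < π) :
    ∃ c : ℝ, 0 < c ∧ (negCothHalf s).re = c * -Real.sinh s.re ∧
      (negCothHalf s).im = c * Real.sin s.im := by
  have hne := one_sub_exp_ne_zero_of_mem_strip h0 hpi
  have hn : 0 < Complex.normSq (1 - Complex.exp s) := Complex.normSq_pos.2 hne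
  have hr := Real.exp_pos s.re
  refine ⟨2 * Real.exp s.re / Complex.normSq (1 - Complex.exp s), by positivity, ?_, ?_⟩
  · rw [negCothHalf, Complex.div_re, Real.sinh_eq, Real.exp_neg]
    simp only [Complex.add_re, Complex.sub_re, Complex.add_im, Complex.sub_im, Complex.one_re,
      Complex.one_im, Complex.exp_re, Complex.exp_im]
    field_simp
    linear_combination (-(Real.exp s.re) ^ 2) * Real.sin_sq_add_cos_sq s.im
  · rw [negCothHalf, Complex.div_im]
    simp only [Complex.add_re, Complex.sub_re, Complex.add_im, Complex.sub_im, Complex.one_re,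
      Complex.one_im, Complex.exp_re, Complex.exp_im]
    field_simp
    ring

theorem negCothHalf_im_pos (h0 : 0 < s.im) (hpi : s.im < π) : 0 < (negCothHalf s).im := by
  obtain ⟨c, hc, -, him⟩ := exists_pos_negCothHalf_eq h0 hpi
  rw [him]
  exact mul_pos hc (sin_im_pos_of_mem_strip h0 hpi)

theorem arg_negCothHalf_nonneg (h0 : 0 < s.im) (hpi : s.im < π) : 0 ≤ (negCothHalf s).arg :=
  arg_nonneg_iff.2 (negCothHalf_im_pos h0 hpi).le

theorem arg_negCothHalf_le (h0 : 0 < s.im) (hpi : s.im < π) (hre : s.re < 0) :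
    (negCothHalf s).arg ≤ Real.sin s.im / Real.sinh (-s.re) := by
  obtain ⟨c, hc, hr, hi⟩ := exists_pos_negCothHalf_eq h0 hpi
  have hsinh : 0 < -Real.sinh s.re := by simpa using Real.sinh_neg_iff.2 hre
  have h := arg_le_im_div_re (hr ▸ mul_pos hc hsinh) (negCothHalf_im_pos h0 hpi).le
  rwa [hr, hi, mul_div_mul_left _ _ hc.ne', ← Real.sinh_neg] at h

theorem pi_sub_arg_negCothHalf_le (h0 : 0 < s.im) (hpi : s.im < π) (hre : 0 < s.re) :
    π - (negCothHalf s).arg ≤ Real.sin s.im / Real.sinh s.re := by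
  obtain ⟨c, hc, hr, hi⟩ := exists_pos_negCothHalf_eq h0 hpi
  have hsinh : 0 < Real.sinh s.re := Real.sinh_pos_iff.2 hre
  have h := pi_sub_arg_le_im_div_neg_re (by rw [hr]; nlinarith [mul_pos hc hsinh])
    (negCothHalf_im_pos h0 hpi)
  rwa [hr, hi, ← mul_neg, neg_neg, mul_div_mul_left _ _ hc.ne'] at h

theorem differentiableAt_log_negCothHalf (h0 : 0 < s.im) (hpi : s.im < π) :
    DifferentiableAt ℂ (fun s => Complex.log (negCothHalf s)) s := by
  have hd : DifferentiableAt ℂ negCothHalf s := by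
    unfold negCothHalf
    exact ((differentiableAt_const _).add Complex.differentiableAt_exp).div
      ((differentiableAt_const _).sub Complex.differentiableAt_exp)
      (one_sub_exp_ne_zero_of_mem_strip h0 hpi)
  exact hd.clog (mem_slitPlane_iff.2 (Or.inr (negCothHalf_im_pos h0 hpi).ne'))

end negCothHalf

/-- Two-constants principle in a strip: a bound `ε ^ Re K * A` with `K` holomorphic and `Re K`
bounded above propagates from the boundary lines to the strip. -/
theorem norm_le_rpow_mul_of_boundary {a b A ε R : ℝ} {W K : ℂ → ℂ} (hab : a < b)
    (hε0 : 0 < ε) (hε1 : ε ≤ 1) (hW : DiffContOnCl ℂ W (im ⁻¹' Ioo a b))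
    (hWbdd : ∃ C : ℝ, ∀ z : ℂ, a < z.im → z.im < b → ‖W z‖ ≤ C)
    (hK : DiffContOnCl ℂ K (im ⁻¹' Ioo a b))
    (hKR : ∀ z : ℂ, a < z.im → z.im < b → (K z).re ≤ R)
    (ha : ∀ z : ℂ, z.im = a → ‖W z‖ ≤ ε ^ (K z).re * A)
    (hb : ∀ z : ℂ, z.im = b → ‖W z‖ ≤ ε ^ (K z).re * A)
    {z : ℂ} (hza : a < z.im) (hzb : z.im < b) : ‖W z‖ ≤ ε ^ (K z).re * A := by
  set F : ℂ → ℂ := fun w => Complex.exp (-K w * Real.log ε) with hF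
  have hnorm : ∀ w, ‖F w‖ = (ε ^ (K w).re)⁻¹ := fun w => by
    rw [hF, Complex.norm_exp, Complex.re_mul_ofReal, Real.rpow_def_of_pos hε0, ← Real.exp_neg]
    congr 1
    rw [Complex.neg_re]
    ring
  have key : ∀ w, ‖W w * F w‖ ≤ A ↔ ‖W w‖ ≤ ε ^ (K w).re * A := fun w => by
    rw [norm_mul, hnorm, ← div_eq_mul_inv, div_le_iff₀' (Real.rpow_pos_of_pos hε0 _)]
  have hFd : DiffContOnCl ℂ F (im ⁻¹' Ioo a b) := by
    have hg : Differentiable ℂ fun u : ℂ => Complex.exp (-u * Real.log ε) := by fun_prop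
    exact hg.comp_diffContOnCl hK
  refine (key z).1 (PhragmenLindelof.horizontal_strip (f := fun w => W w * F w) (hW.smul hFd)
    ⟨0, div_pos Real.pi_pos (sub_pos.2 hab), 0, ?_⟩ (fun w hw => (key w).2 (ha w hw))
    (fun w hw => (key w).2 (hb w hw)) hza.le hzb.le)
  obtain ⟨C, hC⟩ := hWbdd
  refine Asymptotics.IsBigO.of_bound (C * (ε ^ R)⁻¹) ?_
  refine Filter.Eventually.filter_mono inf_le_right (eventually_principal.2 fun w hw => ?_)
  obtain ⟨hwa, hwb⟩ : a < w.im ∧ w.im < b := hw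
  have hCw := hC w hwa hwb
  have hpos := Real.rpow_pos_of_pos hε0 R
  simp only [zero_mul, Real.exp_zero, norm_one, mul_one, norm_mul, hnorm]
  refine mul_le_mul hCw (inv_anti₀ hpos ?_) (by positivity) ((norm_nonneg _).trans hCw)
  exact Real.rpow_le_rpow_of_exponent_ge hε0 hε1 (hKR w hwa hwb)

/-- The two-sided estimate in terms of the harmonic measure of `{|Re z| > N}` on the boundary of
the enlarged strip `a - δ < Im z < b + δ`. -/
theorem norm_le_rpow_mul_of_enlarged_strip {a b M A ε N δ : ℝ} {W : ℂ → ℂ}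
    (hab : a < b) (hA : 0 < A) (hε0 : 0 < ε) (hε1 : ε ≤ 1)
    (hW : DiffContOnCl ℂ W (im ⁻¹' Ioo a b))
    (hWbdd : ∃ C : ℝ, ∀ z : ℂ, a < z.im → z.im < b → ‖W z‖ ≤ C)
    (hout : ∀ z : ℂ, z.im = a ∨ z.im = b → M < |z.re| → ‖W z‖ ≤ A)
    (hin : ∀ z : ℂ, z.im = a ∨ z.im = b → |z.re| ≤ M → ‖W z‖ ≤ ε * A)
    (hδ : 0 < δ) (hNM : N < M) {z : ℂ} (hza : a < z.im) (hzb : z.im < b) (hzN : |z.re| < N) :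
    ‖W z‖ ≤ ε ^ (1 - δ / (b - a + 2 * δ) / Real.sinh (π / (b - a + 2 * δ) * (M - N)) -
      2 * ((z.im - a + δ) / (b - a + 2 * δ)) /
        Real.sinh (π / (b - a + 2 * δ) * (N - |z.re|))) * A := by
  have hL : 0 < b - a + 2 * δ := by linarith
  set L := b - a + 2 * δ with hLdef
  set k := π / L with hk
  have hk0 : 0 < k := div_pos Real.pi_pos hL
  have hkL : k * L = π := div_mul_cancel₀ _ hL.ne'
  set η := δ / L / Real.sinh (k * (M - N)) with hη
  have hsinhMN : 0 < Real.sinh (k * (M - N)) :=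
    Real.sinh_pos_iff.2 (mul_pos hk0 (sub_pos.2 hNM))
  have hη0 : 0 ≤ η := by positivity
  set r : ℂ → ℂ := fun w => k * (w - (N + (a - δ : ℝ) * I)) with hr
  set l : ℂ → ℂ := fun w => k * ((b + δ : ℝ) * I - N - w) with hl
  have r_re : ∀ w, (r w).re = k * (w.re - N) := fun w => by simp [hr]
  have r_im : ∀ w, (r w).im = k * (w.im - a + δ) := fun w => by
    simp only [hr, Complex.im_ofReal_mul]; simp; left; ring
  have l_re : ∀ w, (l w).re = k * (-w.re - N) := fun w => by
    simp only [hl, Complex.re_ofReal_mul]; simp; left; ring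
  have l_im : ∀ w, (l w).im = π - (r w).im := fun w => by
    rw [r_im, ← hkL, hLdef]
    simp only [hl, Complex.im_ofReal_mul]; simp; ring
  have r_pos : ∀ w : ℂ, a ≤ w.im → 0 < (r w).im := fun w hw => by
    rw [r_im]; exact mul_pos hk0 (by linarith)
  have r_lt : ∀ w : ℂ, w.im ≤ b → (r w).im < π := fun w hw => by
    rw [r_im, ← hkL]; exact mul_lt_mul_of_pos_left (by linarith) hk0
  have l_pos : ∀ w : ℂ, w.im ≤ b → 0 < (l w).im := fun w hw => by
    rw [l_im]; linarith [r_lt w hw]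
  have l_lt : ∀ w : ℂ, a ≤ w.im → (l w).im < π := fun w hw => by
    rw [l_im]; linarith [r_pos w hw]
  have hsin : ∀ w, Real.sin (l w).im = Real.sin (r w).im := fun w => by
    rw [l_im, Real.sin_pi_sub]
  set K : ℂ → ℂ := fun w => (1 - η : ℝ) +
    (1 / π : ℝ) * (I * (Complex.log (negCothHalf (r w)) + Complex.log (negCothHalf (l w)))) with hK
  have K_re : ∀ w, (K w).re =
      1 - η - ((negCothHalf (r w)).arg + (negCothHalf (l w)).arg) / π := fun w => by
    simp only [hK, Complex.add_re, Complex.re_ofReal_mul, Complex.ofReal_re, Complex.I_mul_re,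
      Complex.add_im, Complex.log_im]
    ring
  have hsum : ∀ w : ℂ, a ≤ w.im → w.im ≤ b →
      0 ≤ ((negCothHalf (r w)).arg + (negCothHalf (l w)).arg) / π := fun w h1 h2 =>
    div_nonneg (add_nonneg (arg_negCothHalf_nonneg (r_pos w h1) (r_lt w h2))
      (arg_negCothHalf_nonneg (l_pos w h2) (l_lt w h1))) Real.pi_pos.le
  have K_le : ∀ w : ℂ, a ≤ w.im → w.im ≤ b → (K w).re ≤ 1 := fun w h1 h2 => by
    rw [K_re]; linarith [hsum w h1 h2]
  have hKd : DiffContOnCl ℂ K (im ⁻¹' Ioo a b) := by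
    refine DifferentiableOn.diffContOnCl fun w hw => DifferentiableAt.differentiableWithinAt ?_
    rw [closure_preimage_im, closure_Ioo hab.ne] at hw
    have hw' : a ≤ w.im ∧ w.im ≤ b := hw
    have hdr : DifferentiableAt ℂ r w := by fun_prop
    have hdl : DifferentiableAt ℂ l w := by fun_prop
    have h1 := (differentiableAt_log_negCothHalf (r_pos w hw'.1) (r_lt w hw'.2)).comp w hdr
    have h2 := (differentiableAt_log_negCothHalf (l_pos w hw'.2) (l_lt w hw'.1)).comp w hdl
    exact (((h1.add h2).const_mul I).const_mul _).const_add _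
  have sin_le : ∀ w : ℂ, w.im = a ∨ w.im = b → Real.sin (r w).im ≤ k * δ := by
    rintro w (h | h)
    · have := Real.sin_le (r_pos w h.ge).le
      rwa [r_im, h, sub_self, zero_add] at this ⊢
    · have h1 : (l w).im = k * δ := by rw [l_im, r_im, h, ← hkL, hLdef]; ring
      rw [← hsin, h1]
      exact Real.sin_le (by positivity)
  -- On the boundary, the part of the line on which `s` lies far to the right has large `arg`.
  have arg_ge : ∀ s : ℂ, 0 < s.im → s.im < π → Real.sin s.im ≤ k * δ → k * (M - N) ≤ s.re →
      π - π * η ≤ (negCothHalf s).arg := fun s h0 hpi hs hre => by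
    have hkMN : 0 < k * (M - N) := mul_pos hk0 (sub_pos.2 hNM)
    have h1 := pi_sub_arg_negCothHalf_le h0 hpi (hkMN.trans_le hre)
    have h2 : Real.sin s.im / Real.sinh s.re ≤ k * δ / Real.sinh (k * (M - N)) :=
      div_le_div₀ (by positivity) hs hsinhMN (Real.sinh_le_sinh.2 hre)
    have h3 : k * δ / Real.sinh (k * (M - N)) = π * η := by rw [hη, hk]; ring
    linarith
  have hbd : ∀ w : ℂ, w.im = a ∨ w.im = b → ‖W w‖ ≤ ε ^ (K w).re * A := fun w hw => by
    have h1 : a ≤ w.im := by rcases hw with h | h <;> linarith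
    have h2 : w.im ≤ b := by rcases hw with h | h <;> linarith
    rcases le_or_gt |w.re| M with hM | hM
    · refine (hin w hw hM).trans (mul_le_mul_of_nonneg_right ?_ hA.le)
      simpa using Real.rpow_le_rpow_of_exponent_ge hε0 hε1 (K_le w h1 h2)
    · refine (hout w hw hM).trans (le_mul_of_one_le_left hA.le
        (Real.one_le_rpow_of_pos_of_le_one_of_nonpos hε0 hε1 ?_))
      have hr0 := arg_negCothHalf_nonneg (r_pos w h1) (r_lt w h2)
      have hl0 := arg_negCothHalf_nonneg (l_pos w h2) (l_lt w h1)
      have hge : π - π * η ≤ (negCothHalf (r w)).arg + (negCothHalf (l w)).arg := by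
        rcases lt_abs.1 hM with h | h
        · have := arg_ge (r w) (r_pos w h1) (r_lt w h2) (sin_le w hw)
            (by rw [r_re]; exact mul_le_mul_of_nonneg_left (by linarith) hk0.le)
          linarith
        · have := arg_ge (l w) (l_pos w h2) (l_lt w h1) ((hsin w).trans_le (sin_le w hw))
            (by rw [l_re]; exact mul_le_mul_of_nonneg_left (by linarith) hk0.le)
          linarith
      have : 1 - η ≤ ((negCothHalf (r w)).arg + (negCothHalf (l w)).arg) / π := by
        rw [le_div_iff₀ Real.pi_pos]; linarith
      rw [K_re]; linarith
  refine (norm_le_rpow_mul_of_boundary hab hε0 hε1 hW hWbdd hKd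
    (fun w h1 h2 => K_le w h1.le h2.le) (fun w h => hbd w (Or.inl h))
    (fun w h => hbd w (Or.inr h)) hza hzb).trans (mul_le_mul_of_nonneg_right
    (Real.rpow_le_rpow_of_exponent_ge hε0 hε1 ?_) hA.le)
  have hkN : 0 < k * (N - |z.re|) := mul_pos hk0 (sub_pos.2 hzN)
  have hS : 0 < Real.sinh (k * (N - |z.re|)) := Real.sinh_pos_iff.2 hkN
  have arg_le : ∀ s : ℂ, 0 < s.im → s.im < π → Real.sin s.im ≤ (r z).im →
      s.re ≤ -(k * (N - |z.re|)) →
      (negCothHalf s).arg ≤ (r z).im / Real.sinh (k * (N - |z.re|)) := fun s h0 hpi hs hre =>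
    (arg_negCothHalf_le h0 hpi (by linarith)).trans
      (div_le_div₀ (r_pos z hza.le).le hs hS (Real.sinh_le_sinh.2 (by linarith)))
  have hsz := Real.sin_le (r_pos z hza.le).le
  have hR := arg_le (r z) (r_pos z hza.le) (r_lt z hzb.le) hsz
    (by rw [r_re, ← mul_neg]
        exact mul_le_mul_of_nonneg_left (by linarith [le_abs_self z.re]) hk0.le)
  have hLft := arg_le (l z) (l_pos z hzb.le) (l_lt z hza.le) ((hsin z).trans_le hsz)
    (by rw [l_re, ← mul_neg]
        exact mul_le_mul_of_nonneg_left (by linarith [neg_abs_le z.re]) hk0.le)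
  have hfin : ((negCothHalf (r z)).arg + (negCothHalf (l z)).arg) / π ≤
      2 * ((z.im - a + δ) / L) / Real.sinh (k * (N - |z.re|)) := by
    rw [div_le_iff₀ Real.pi_pos]
    refine (add_le_add hR hLft).trans_eq ?_
    rw [r_im, hk]
    ring
  rw [K_re]
  linarith

/-- **Two-sided quantified three-lines lemma.**
If `W` is holomorphic and bounded on the band `{a < Im z < b}`, continuous on the
closure, with `|W| ≤ A` on both boundary lines for `|Re z| > M` and `|W| ≤ εA` on both
boundary lines for `|Re z| ≤ M`, then for `z` in the open band with `|Re z| < M` and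
`t = (Im z - a)/(b - a)`, `|W(z)| ≤ ε^g A` where
`g = 1 - 4t e^{-π(M-|Re z|)/(b-a)} / (1 - e^{-π(M-|Re z|)/(b-a)})`, provided `g ≥ 0`. -/
theorem stmt15 (a b M A ε : ℝ) (hab : a < b) (hM : 0 < M) (hA : 0 < A)
    (hε0 : 0 < ε) (hε1 : ε ≤ 1) (W : ℂ → ℂ)
    (hW : DifferentiableOn ℂ W {z : ℂ | a < z.im ∧ z.im < b})
    (hWbdd : ∃ C : ℝ, ∀ z : ℂ, a < z.im → z.im < b → ‖W z‖ ≤ C)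
    (hWc : ContinuousOn W {z : ℂ | a ≤ z.im ∧ z.im ≤ b})
    (ha_out : ∀ x : ℝ, M < |x| → ‖W (x + a * Complex.I)‖ ≤ A)
    (hb_out : ∀ x : ℝ, M < |x| → ‖W (x + b * Complex.I)‖ ≤ A)
    (ha_in : ∀ x : ℝ, |x| ≤ M → ‖W (x + a * Complex.I)‖ ≤ ε * A)
    (hb_in : ∀ x : ℝ, |x| ≤ M → ‖W (x + b * Complex.I)‖ ≤ ε * A) :
    ∀ z : ℂ, a < z.im → z.im < b → |z.re| < M →
      ∀ t g : ℝ, t = (z.im - a) / (b - a) →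
        g = 1 - 4 * t * Real.exp (-π * (M - |z.re|) / (b - a)) /
              (1 - Real.exp (-π * (M - |z.re|) / (b - a))) →
        0 ≤ g → ‖W z‖ ≤ ε ^ g * A := by
  intro z hza hzb hzM t g ht hg _
  have hL : 0 < b - a := sub_pos.2 hab
  have hclos : closure (im ⁻¹' Ioo a b) = {z : ℂ | a ≤ z.im ∧ z.im ≤ b} := by
    rw [closure_preimage_im, closure_Ioo hab.ne]
    rfl
  have hWd : DiffContOnCl ℂ W (im ⁻¹' Ioo a b) := ⟨hW, hclos ▸ hWc⟩
  have hout : ∀ z : ℂ, z.im = a ∨ z.im = b → M < |z.re| → ‖W z‖ ≤ A := by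
    rintro z (h | h) hz
    · simpa only [← h, Complex.re_add_im] using ha_out z.re hz
    · simpa only [← h, Complex.re_add_im] using hb_out z.re hz
  have hin : ∀ z : ℂ, z.im = a ∨ z.im = b → |z.re| ≤ M → ‖W z‖ ≤ ε * A := by
    rintro z (h | h) hz
    · simpa only [← h, Complex.re_add_im] using ha_in z.re hz
    · simpa only [← h, Complex.re_add_im] using hb_in z.re hz
  have sinh_ne : ∀ u : ℝ, 0 < u → Real.sinh (π / (b - a) * u) ≠ 0 := fun u hu =>
    (Real.sinh_pos_iff.2 (by positivity)).ne'
  have hsmaller : ∀ N : ℝ, |z.re| < N → N < M →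
      ‖W z‖ ≤ ε ^ (1 - 2 * t / Real.sinh (π / (b - a) * (N - |z.re|))) * A := by
    intro N hzN hNM
    -- Let the enlargement `δ` of the strip tend to zero.
    have h1 := sinh_ne _ (sub_pos.2 hNM)
    have h2 := sinh_ne _ (sub_pos.2 hzN)
    have hcont : ContinuousAt (fun δ : ℝ =>
        ε ^ (1 - δ / (b - a + 2 * δ) / Real.sinh (π / (b - a + 2 * δ) * (M - N)) -
          2 * ((z.im - a + δ) / (b - a + 2 * δ)) /
            Real.sinh (π / (b - a + 2 * δ) * (N - |z.re|))) * A) 0 := by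
      refine ContinuousAt.mul (ContinuousAt.rpow continuousAt_const ?_ (Or.inl hε0.ne'))
        continuousAt_const
      have h3 : b - a + 2 * (0 : ℝ) ≠ 0 := by linarith
      have hs : ∀ u : ℝ, ContinuousAt (fun δ : ℝ => Real.sinh (π / (b - a + 2 * δ) * u)) 0 :=
        fun u => Real.continuous_sinh.continuousAt.comp
          (f := fun δ : ℝ => π / (b - a + 2 * δ) * u) (by fun_prop (disch := exact h3))
      refine (continuousAt_const.sub (ContinuousAt.div ?_ (hs _) (by simpa using h1))).sub
        (ContinuousAt.div ?_ (hs _) (by simpa using h2))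
      · fun_prop (disch := exact h3)
      · fun_prop (disch := exact h3)
    have hlim := hcont.tendsto.mono_left (nhdsWithin_le_nhds (s := Ioi 0))
    have h := ge_of_tendsto hlim (eventually_nhdsWithin_of_forall fun δ hδ =>
      norm_le_rpow_mul_of_enlarged_strip hab hA hε0 hε1 hWd hWbdd hout hin hδ hNM hza hzb hzN)
    simpa [ht] using h
  have hlim : ‖W z‖ ≤ ε ^ (1 - 2 * t / Real.sinh (π / (b - a) * (M - |z.re|))) * A := by
    have hcont : ContinuousAt (fun N : ℝ =>
        ε ^ (1 - 2 * t / Real.sinh (π / (b - a) * (N - |z.re|))) * A) M := by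
      refine ContinuousAt.mul (ContinuousAt.rpow continuousAt_const ?_ (Or.inl hε0.ne'))
        continuousAt_const
      refine continuousAt_const.sub (ContinuousAt.div continuousAt_const ?_
        (sinh_ne _ (sub_pos.2 hzM)))
      exact Real.continuous_sinh.continuousAt.comp
        (f := fun N : ℝ => π / (b - a) * (N - |z.re|)) (by fun_prop)
    refine ge_of_tendsto (hcont.tendsto.mono_left (nhdsWithin_le_nhds (s := Iio M))) ?_
    filter_upwards [Ioo_mem_nhdsLT hzM] with N hN using hsmaller N hN.1 hN.2
  refine hlim.trans (mul_le_mul_of_nonneg_right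
    (Real.rpow_le_rpow_of_exponent_ge hε0 hε1 ?_) hA.le)
  have ht0 : 0 < t := ht ▸ div_pos (sub_pos.2 hza) hL
  set v := π / (b - a) * (M - |z.re|) with hv
  have hv0 : 0 < v := mul_pos (div_pos Real.pi_pos hL) (sub_pos.2 hzM)
  have hexp : -π * (M - |z.re|) / (b - a) = -v := by rw [hv]; ring
  rw [hg, hexp]
  refine sub_le_sub_left ?_ 1
  have hq1 : Real.exp (-v) < 1 := Real.exp_zero ▸ Real.exp_lt_exp.2 (by linarith)
  have hq0 := Real.exp_pos (-v)
  have hs0 : 0 < Real.sinh v := Real.sinh_pos_iff.2 hv0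
  have hprod : Real.exp v * Real.exp (-v) = 1 := by rw [← Real.exp_add]; simp
  rw [div_le_div_iff₀ hs0 (by linarith), Real.sinh_eq]
  nlinarith [mul_pos ht0 hq0, mul_pos (mul_pos ht0 hq0) (sub_pos.2 hq1)]
end
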